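/- arXiv:1709.08838 — 7 statements merged into one kernel-verified Lean document; each statement's English description precedes it below -/
import Mathlib

section
/- Let ρ > 0, 0 < a < b, and let μ > 0 and ν > 0. Let g : ℝ → ℝ be continuous on [a,b]. Then for every t ∈ (a,b], the semigroup property (ρI_{a+}^μ (ρI_{a+}^ν g))(t) = (ρI_{a+}^{μ+ν} g)(t) holds; explicitly, (1/Γ(μ)) ∫_a^t s^{ρ-1} ((t^ρ - s^ρ)/ρ)^{μ-1} [ (1/Γ(ν)) ∫_a^s u^{ρ-1} ((s^ρ - u^ρ)/ρ)^{ν-1} g(u) du ] ds = (1/Γ(μ+ν)) ∫_a^t s^{ρ-1} ((t^ρ - s^ρ)/ρ)^{μ+ν-1} g(s) ds. -/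
open Real intervalIntegral

lemma kat_beta (μ ν : ℝ) (hμ : 0 < μ) (hν : 0 < ν) (y T : ℝ) (h : y < T) :
    ∫ x in y..T, (T - x) ^ (μ - 1) * (x - y) ^ (ν - 1)
      = Real.Gamma μ * Real.Gamma ν / Real.Gamma (μ + ν) * (T - y) ^ (μ + ν - 1) := by
  have hT : 0 < T - y := sub_pos.2 h
  have h1 := Complex.betaIntegral_scaled (ν : ℂ) (μ : ℂ) hT
  rw [Complex.betaIntegral_eq_Gamma_mul_div _ _ (by simpa using hν) (by simpa using hμ)] at h1
  have h2 : (∫ x in (0:ℝ)..(T - y), (x : ℂ) ^ ((ν : ℂ) - 1) * (((T - y : ℝ) : ℂ) - x) ^ ((μ : ℂ) - 1))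
      = ((∫ x in (0:ℝ)..(T - y), x ^ (ν - 1) * ((T - y) - x) ^ (μ - 1) : ℝ) : ℂ) := by
    rw [← intervalIntegral.integral_ofReal]
    apply intervalIntegral.integral_congr
    intro x hx
    rw [Set.uIcc_of_le hT.le] at hx
    simp only
    rw [Complex.ofReal_mul, Complex.ofReal_cpow hx.1, Complex.ofReal_cpow (sub_nonneg.2 hx.2)]
    push_cast
    rfl
  rw [h2] at h1
  have h3 : (∫ x in (0:ℝ)..(T - y), x ^ (ν - 1) * ((T - y) - x) ^ (μ - 1))
     = (T - y) ^ (ν + μ - 1) * (Real.Gamma ν * Real.Gamma μ / Real.Gamma (ν + μ)) := by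
    apply Complex.ofReal_injective
    rw [h1]
    push_cast [Complex.ofReal_cpow hT.le, Complex.Gamma_ofReal, ← Complex.Gamma_ofReal]
    rfl
  have h4 := intervalIntegral.integral_comp_sub_right (a := y) (b := T)
    (fun x => x ^ (ν - 1) * ((T - y) - x) ^ (μ - 1)) y
  rw [sub_self, h3] at h4
  rw [add_comm μ ν, mul_comm (Real.Gamma μ), mul_comm _ ((T - y) ^ _), ← h4]
  congr 1; ext x
  rw [mul_comm]; congr 2; ring

lemma kat_beta_int (μ ν : ℝ) (hμ : 0 < μ) (hν : 0 < ν) (y T : ℝ) (h : y < T) :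
    IntervalIntegrable (fun x => (T - x) ^ (μ - 1) * (x - y) ^ (ν - 1)) MeasureTheory.volume y T := by
  by_contra hc
  have h1 := intervalIntegral.integral_undef hc
  rw [kat_beta μ ν hμ hν y T h] at h1
  have := Real.Gamma_pos_of_pos hμ
  have := Real.Gamma_pos_of_pos hν
  have := Real.Gamma_pos_of_pos (add_pos hμ hν)
  have := Real.rpow_pos_of_pos (sub_pos.2 h) (μ + ν - 1)
  have : 0 < Real.Gamma μ * Real.Gamma ν / Real.Gamma (μ + ν) * (T - y) ^ (μ + ν - 1) := by positivity
  linarith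

open MeasureTheory in
lemma kat_RL (μ ν : ℝ) (hμ : 0 < μ) (hν : 0 < ν) (A T : ℝ) (hAT : A < T) (h : ℝ → ℝ)
    (hh : ContinuousOn h (Set.Icc A T)) :
    ∫ x in A..T, (T - x) ^ (μ - 1) * ∫ y in A..x, (x - y) ^ (ν - 1) * h y
      = Real.Gamma μ * Real.Gamma ν / Real.Gamma (μ + ν) *
        ∫ y in A..T, (T - y) ^ (μ + ν - 1) * h y := by
  set c := Real.Gamma μ * Real.Gamma ν / Real.Gamma (μ + ν) with hc
  set m := (volume : Measure ℝ).restrict (Set.Ioc A T) with hm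
  let F : ℝ → ℝ → ℝ := fun x y => Set.indicator {p : ℝ × ℝ | p.2 ≤ p.1}
    (fun p => (T - p.1) ^ (μ - 1) * (p.1 - p.2) ^ (ν - 1)) (x, y) * h y
  have hF1 : ∀ x, F x = (Set.Iic x).indicator
      (fun y => (T - x) ^ (μ - 1) * ((x - y) ^ (ν - 1) * h y)) := by
    intro x; ext y
    by_cases hxy : y ≤ x <;> simp [F, hxy, mul_assoc]
  have hF2 : ∀ y, (fun x => F x y) = fun x => (Set.Ici y).indicator
      (fun x => (T - x) ^ (μ - 1) * (x - y) ^ (ν - 1)) x * h y := by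
    intro y; ext x
    by_cases hxy : y ≤ x <;> simp [F, hxy]
  have hset : ∀ y ∈ Set.Ioo A T, Set.Ioc A T ∩ Set.Ici y = Set.Icc y T := by
    intro y hy; ext x
    simp only [Set.mem_inter_iff, Set.mem_Ioc, Set.mem_Ici, Set.mem_Icc]
    constructor
    · rintro ⟨⟨_, h2⟩, h3⟩; exact ⟨h3, h2⟩
    · rintro ⟨h3, h2⟩; exact ⟨⟨hy.1.trans_le h3, h2⟩, h3⟩
  have hae : ∀ᵐ y ∂m, y ∈ Set.Ioo A T := by
    rw [hm, ← Measure.restrict_congr_set Ioo_ae_eq_Ioc]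
    exact ae_restrict_mem measurableSet_Ioo
  have hint : ∀ y ∈ Set.Ioo A T, Integrable ((Set.Ici y).indicator
      (fun x => (T - x) ^ (μ - 1) * (x - y) ^ (ν - 1))) m := by
    intro y hy
    rw [integrable_indicator_iff measurableSet_Ici, IntegrableOn, hm,
      Measure.restrict_restrict measurableSet_Ici, Set.inter_comm, hset y hy]
    have := kat_beta_int μ ν hμ hν y T hy.2
    rw [intervalIntegrable_iff_integrableOn_Icc_of_le hy.2.le] at this
    exact this
  have hval : ∀ y ∈ Set.Ioo A T, ∫ x, (Set.Ici y).indicator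
      (fun x => (T - x) ^ (μ - 1) * (x - y) ^ (ν - 1)) x ∂m = c * (T - y) ^ (μ + ν - 1) := by
    intro y hy
    rw [MeasureTheory.integral_indicator measurableSet_Ici, hm,
      Measure.restrict_restrict measurableSet_Ici, Set.inter_comm, hset y hy,
      integral_Icc_eq_integral_Ioc, ← intervalIntegral.integral_of_le hy.2.le,
      kat_beta μ ν hμ hν y T hy.2]
  have hpow : IntervalIntegrable (fun y => (T - y) ^ (μ + ν - 1)) volume A T := by
    have := (intervalIntegral.intervalIntegrable_rpow' (a := T - A) (b := 0) (r := μ + ν - 1)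
      (by linarith)).comp_sub_left T
    simpa using this
  have hpowh : IntervalIntegrable (fun y => (T - y) ^ (μ + ν - 1) * h y) volume A T :=
    hpow.mul_continuousOn (by rwa [Set.uIcc_of_le hAT.le])
  have hmeas : AEStronglyMeasurable (Function.uncurry F) (m.prod m) := by
    apply AEStronglyMeasurable.mul
    · apply Measurable.aestronglyMeasurable
      apply Measurable.indicator
      · fun_prop
      · exact measurableSet_le measurable_snd measurable_fst
    · exact ((hh.mono Set.Ioc_subset_Icc_self).aestronglyMeasurable measurableSet_Ioc).comp_snd
  have hFint : Integrable (Function.uncurry F) (m.prod m) := by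
    rw [integrable_prod_iff' hmeas]
    constructor
    · filter_upwards [hae] with y hy
      have := (hint y hy).mul_const (h y)
      rw [← hF2] at this
      exact this
    · have h1 : Integrable (fun y => c * ‖(T - y) ^ (μ + ν - 1) * h y‖) m :=
        (((intervalIntegrable_iff_integrableOn_Ioc_of_le hAT.le).1 hpowh).norm).const_mul c
      apply h1.congr
      filter_upwards [hae] with y hy
      have h2 : ∫ x, ‖Function.uncurry F (x, y)‖ ∂m = ∫ x, (Set.Ici y).indicator
          (fun x => (T - x) ^ (μ - 1) * (x - y) ^ (ν - 1)) x * |h y| ∂m := by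
        apply MeasureTheory.integral_congr_ae
        filter_upwards [ae_restrict_mem measurableSet_Ioc] with x hx
        have h3 : F x y = _ := congrFun (hF2 y) x
        simp only [Function.uncurry_apply_pair]
        rw [h3, norm_mul, Real.norm_eq_abs, Real.norm_eq_abs, abs_of_nonneg]
        apply Set.indicator_apply_nonneg
        intro hxy
        exact mul_nonneg (Real.rpow_nonneg (sub_nonneg.2 hx.2) _)
          (Real.rpow_nonneg (sub_nonneg.2 hxy) _)
      rw [h2, MeasureTheory.integral_mul_const, hval y hy, norm_mul, Real.norm_eq_abs,
        Real.norm_eq_abs, abs_of_nonneg (Real.rpow_nonneg (sub_nonneg.2 hy.2.le) _), mul_assoc]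
  have hswap := integral_integral_swap hFint
  have hL : ∫ x, ∫ y, F x y ∂m ∂m
      = ∫ x in A..T, (T - x) ^ (μ - 1) * ∫ y in A..x, (x - y) ^ (ν - 1) * h y := by
    rw [intervalIntegral.integral_of_le hAT.le]
    apply MeasureTheory.integral_congr_ae
    filter_upwards [ae_restrict_mem measurableSet_Ioc] with x hx
    have : Set.Iic x ∩ Set.Ioc A T = Set.Ioc A x := by
      ext y
      simp only [Set.mem_inter_iff, Set.mem_Ioc, Set.mem_Iic]
      constructor
      · rintro ⟨h3, h1, h2⟩; exact ⟨h1, h3⟩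
      · rintro ⟨h1, h3⟩; exact ⟨h3, h1, h3.trans hx.2⟩
    rw [hF1, MeasureTheory.integral_indicator measurableSet_Iic, hm,
      Measure.restrict_restrict measurableSet_Iic, this, MeasureTheory.integral_const_mul,
      intervalIntegral.integral_of_le hx.1.le]
  have hR : ∫ y, ∫ x, F x y ∂m ∂m = c * ∫ y in A..T, (T - y) ^ (μ + ν - 1) * h y := by
    rw [intervalIntegral.integral_of_le hAT.le, ← MeasureTheory.integral_const_mul]
    apply MeasureTheory.integral_congr_ae
    filter_upwards [hae] with y hy
    rw [hF2, MeasureTheory.integral_mul_const, hval y hy, mul_assoc]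
  rw [← hL, ← hR, hswap]

lemma kat_sub (ρ a s : ℝ) (hρ : 0 < ρ) (ha : 0 < a) (has : a ≤ s) (G : ℝ → ℝ) :
    ∫ u in a..s, u ^ (ρ - 1) * G (u ^ ρ / ρ) = ∫ y in (a ^ ρ / ρ)..(s ^ ρ / ρ), G y := by
  rw [← intervalIntegral.integral_comp_mul_deriv_of_deriv_nonneg (f := fun u => u ^ ρ / ρ)
    (f' := fun u => u ^ (ρ - 1)) (g := G)]
  · simp [mul_comm]
  · exact ((Real.continuous_rpow_const hρ.le).div_const ρ).continuousOn
  · intro x hx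
    rw [min_eq_left has] at hx
    have := (Real.hasDerivAt_rpow_const (x := x) (p := ρ) (Or.inl (ha.trans hx.1).ne')).div_const ρ
    rwa [mul_div_cancel_left₀ _ hρ.ne'] at this
  · intro x hx
    rw [min_eq_left has] at hx
    exact Real.rpow_nonneg (ha.trans hx.1).le _

/-- Semigroup property of the Katugampola fractional integral. -/
theorem katugampola_integral_semigroup
    (ρ a b μ ν : ℝ) (hρ : 0 < ρ) (ha : 0 < a) (hab : a < b) (hμ : 0 < μ) (hν : 0 < ν)
    (g : ℝ → ℝ) (hg : ContinuousOn g (Set.Icc a b))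
    (t : ℝ) (ht : t ∈ Set.Ioc a b) :
    (1 / Real.Gamma μ) * ∫ s in a..t, s ^ (ρ - 1) * ((t ^ ρ - s ^ ρ) / ρ) ^ (μ - 1) *
      ((1 / Real.Gamma ν) * ∫ u in a..s, u ^ (ρ - 1) * ((s ^ ρ - u ^ ρ) / ρ) ^ (ν - 1) * g u)
    = (1 / Real.Gamma (μ + ν)) *
        ∫ s in a..t, s ^ (ρ - 1) * ((t ^ ρ - s ^ ρ) / ρ) ^ (μ + ν - 1) * g s := by
  obtain ⟨hat, htb⟩ := ht
  let h : ℝ → ℝ := fun y => g ((ρ * y) ^ (1 / ρ))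
  have hinv : ∀ u, 0 < u → h (u ^ ρ / ρ) = g u := by
    intro u hu
    simp only [h]
    rw [mul_div_cancel₀ _ hρ.ne', ← Real.rpow_mul hu.le, mul_one_div_cancel hρ.ne', Real.rpow_one]
  have key : ∀ s, a ≤ s → ∀ κ : ℝ,
      ∫ u in a..s, u ^ (ρ - 1) * ((s ^ ρ - u ^ ρ) / ρ) ^ (κ - 1) * g u
      = ∫ y in (a ^ ρ / ρ)..(s ^ ρ / ρ), (s ^ ρ / ρ - y) ^ (κ - 1) * h y := by
    intro s hs κ
    rw [← kat_sub ρ a s hρ ha hs]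
    apply intervalIntegral.integral_congr
    intro u hu
    rw [Set.uIcc_of_le hs] at hu
    simp only
    rw [hinv u (ha.trans_le hu.1), sub_div, mul_assoc]
  have hAT : a ^ ρ / ρ < t ^ ρ / ρ :=
    div_lt_div_of_pos_right (Real.rpow_lt_rpow ha.le hat hρ) hρ
  have hh : ContinuousOn h (Set.Icc (a ^ ρ / ρ) (t ^ ρ / ρ)) := by
    apply hg.comp
    · exact ((Real.continuous_rpow_const (by positivity)).comp (continuous_const.mul continuous_id)).continuousOn
    · intro y hy
      have hta : 0 < t := ha.trans hat
      have h1 : a ^ ρ ≤ ρ * y := by rw [mul_comm]; exact (div_le_iff₀ hρ).1 hy.1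
      have h2 : ρ * y ≤ t ^ ρ := by rw [mul_comm]; exact (le_div_iff₀ hρ).1 hy.2
      have h0 : 0 < a ^ ρ := Real.rpow_pos_of_pos ha _
      rw [one_div]
      constructor
      · exact (Real.le_rpow_inv_iff_of_pos ha.le (h0.le.trans h1) hρ).2 h1
      · exact ((Real.rpow_inv_le_iff_of_pos (h0.le.trans h1) hta.le hρ).2 h2).trans htb
  have hL : ∫ s in a..t, s ^ (ρ - 1) * ((t ^ ρ - s ^ ρ) / ρ) ^ (μ - 1) *
      ((1 / Real.Gamma ν) * ∫ u in a..s, u ^ (ρ - 1) * ((s ^ ρ - u ^ ρ) / ρ) ^ (ν - 1) * g u)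
      = (1 / Real.Gamma ν) * ∫ x in (a ^ ρ / ρ)..(t ^ ρ / ρ), (t ^ ρ / ρ - x) ^ (μ - 1) *
        ∫ y in (a ^ ρ / ρ)..x, (x - y) ^ (ν - 1) * h y := by
    rw [← kat_sub ρ a t hρ ha hat.le, ← intervalIntegral.integral_const_mul]
    apply intervalIntegral.integral_congr
    intro s hs
    rw [Set.uIcc_of_le hat.le] at hs
    simp only
    rw [key s hs.1 ν, sub_div]
    ring
  rw [hL, key t hat.le (μ + ν), kat_RL μ ν hμ hν _ _ hAT h hh]
  have := (Real.Gamma_pos_of_pos hμ).ne'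
  have := (Real.Gamma_pos_of_pos hν).ne'
  field_simp
end

section
/- Let ρ > 0, a > 0 and 0 < α < 1. Then for every t > a, (1/Γ(1-α)) ∫_a^t s^{ρ-1} ((t^ρ - s^ρ)/ρ)^{-α} ((s^ρ - a^ρ)/ρ)^{α-1} ds = Γ(α); in particular this function of t is constant on (a,∞), so its derivative with respect to t vanishes there, i.e. the Katugampola fractional derivative of order α of the function s ↦ ((s^ρ - a^ρ)/ρ)^{α-1} is identically zero on (a,∞). -/
open Real intervalIntegral

theorem beta_scaled_aux (α T : ℝ) (hα : 0 < α) (hα1 : α < 1) (hT : 0 < T) :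
    ∫ u in (0 : ℝ)..T, (T - u) ^ (-α) * u ^ (α - 1) = Real.Gamma α * Real.Gamma (1 - α) := by
  have h := Complex.betaIntegral_scaled (α : ℂ) (1 - α : ℂ) hT
  rw [Complex.betaIntegral_eq_Gamma_mul_div _ _ (by simpa using hα) (by simpa using hα1)] at h
  have e : (α : ℂ) + (1 - α) = 1 := by ring
  rw [e, sub_self, Complex.cpow_zero, one_mul, Complex.Gamma_one, div_one] at h
  apply Complex.ofReal_injective
  rw [← intervalIntegral.integral_ofReal, Complex.ofReal_mul, ← Complex.Gamma_ofReal,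
    ← Complex.Gamma_ofReal, Complex.ofReal_sub, Complex.ofReal_one, ← h]
  apply intervalIntegral.integral_congr
  intro u hu
  rw [Set.uIcc_of_le hT.le] at hu
  simp only
  rw [Complex.ofReal_mul, Complex.ofReal_cpow (by linarith [hu.2]), Complex.ofReal_cpow hu.1]
  push_cast
  rw [mul_comm]
  congr 2
  ring

theorem katugampola_integral_aux (ρ a α : ℝ) (hρ : 0 < ρ) (ha : 0 < a) (hα : 0 < α) (hα1 : α < 1)
    (t : ℝ) (ht : a < t) :
    (1 / Real.Gamma (1 - α)) * (∫ s in a..t, s ^ (ρ - 1) * ((t ^ ρ - s ^ ρ) / ρ) ^ (-α) *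
        ((s ^ ρ - a ^ ρ) / ρ) ^ (α - 1)) = Real.Gamma α := by
  have hT : 0 < (t ^ ρ - a ^ ρ) / ρ :=
    div_pos (sub_pos.2 (Real.rpow_lt_rpow ha.le ht hρ)) hρ
  have hd : ∀ x : ℝ, 0 < x → HasDerivAt (fun s : ℝ => (s ^ ρ - a ^ ρ) / ρ) (x ^ (ρ - 1)) x := by
    intro x hx
    have := ((Real.hasDerivAt_rpow_const (p := ρ) (Or.inl hx.ne')).sub_const (a ^ ρ)).div_const ρ
    rw [mul_div_cancel_left₀ _ hρ.ne'] at this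
    exact this
  have hc := intervalIntegral.integral_comp_mul_deriv_of_deriv_nonneg (a := a) (b := t)
    (f := fun s : ℝ => (s ^ ρ - a ^ ρ) / ρ) (f' := fun x => x ^ (ρ - 1))
    (g := fun u => ((t ^ ρ - a ^ ρ) / ρ - u) ^ (-α) * u ^ (α - 1))
    (by
      intro x hx
      rw [Set.uIcc_of_le ht.le] at hx
      exact (hd x (ha.trans_le hx.1)).continuousAt.continuousWithinAt)
    (by
      intro x hx
      rw [min_eq_left ht.le] at hx
      exact hd x (ha.trans hx.1))
    (by
      intro x hx
      rw [min_eq_left ht.le] at hx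
      exact Real.rpow_nonneg (ha.trans hx.1).le _)
  simp only [sub_self, zero_div] at hc
  rw [beta_scaled_aux α _ hα hα1 hT] at hc
  have hi : (∫ s in a..t, s ^ (ρ - 1) * ((t ^ ρ - s ^ ρ) / ρ) ^ (-α) *
        ((s ^ ρ - a ^ ρ) / ρ) ^ (α - 1)) = Real.Gamma α * Real.Gamma (1 - α) := by
    rw [← hc]
    apply intervalIntegral.integral_congr
    intro s _
    simp only [Function.comp]
    have : (t ^ ρ - a ^ ρ) / ρ - (s ^ ρ - a ^ ρ) / ρ = (t ^ ρ - s ^ ρ) / ρ := by ring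
    rw [this]
    ring
  rw [hi]
  have := (Real.Gamma_pos_of_pos (sub_pos.2 hα1)).ne'
  field_simp

/-- The Katugampola fractional derivative of order `α` of
`s ↦ ((s^ρ - a^ρ)/ρ)^(α-1)` vanishes on `(a, ∞)`: the fractional integral of order
`1 - α` of this function is the constant `Γ(α)`, hence its derivative vanishes. -/
theorem katugampola_derivative_power_zero
    (ρ a α : ℝ) (hρ : 0 < ρ) (ha : 0 < a) (hα : 0 < α) (hα1 : α < 1)
    (t : ℝ) (ht : a < t) :
    (1 / Real.Gamma (1 - α)) * (∫ s in a..t, s ^ (ρ - 1) * ((t ^ ρ - s ^ ρ) / ρ) ^ (-α) *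
        ((s ^ ρ - a ^ ρ) / ρ) ^ (α - 1)) = Real.Gamma α ∧
    t ^ (1 - ρ) * deriv (fun τ : ℝ =>
      (1 / Real.Gamma (1 - α)) * ∫ s in a..τ, s ^ (ρ - 1) * ((τ ^ ρ - s ^ ρ) / ρ) ^ (-α) *
        ((s ^ ρ - a ^ ρ) / ρ) ^ (α - 1)) t = 0 := by
  refine ⟨katugampola_integral_aux ρ a α hρ ha hα hα1 t ht, ?_⟩
  have h : (fun τ : ℝ =>
      (1 / Real.Gamma (1 - α)) * ∫ s in a..τ, s ^ (ρ - 1) * ((τ ^ ρ - s ^ ρ) / ρ) ^ (-α) *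
        ((s ^ ρ - a ^ ρ) / ρ) ^ (α - 1)) =ᶠ[nhds t] fun _ => Real.Gamma α := by
    filter_upwards [Ioi_mem_nhds ht] with τ hτ
    exact katugampola_integral_aux ρ a α hρ ha hα hα1 τ hτ
  rw [h.deriv_eq, deriv_const, mul_zero]
end

section
/- Let 0 < α < 1, 0 ≤ β < 1, ρ > 0, a > 0, γ = α + β(1-α) (so 0 < γ < 1), and c ∈ ℝ. Let g : (a,∞) → ℝ be continuous with t ↦ ((t^ρ - a^ρ)/ρ)^{1-γ} g(t) bounded on (a,∞). Define x(t) = (c/Γ(γ)) ((t^ρ - a^ρ)/ρ)^{γ-1} + (1/Γ(α)) ∫_a^t s^{ρ-1} ((t^ρ - s^ρ)/ρ)^{α-1} g(s) ds for t > a. Then the Katugampola fractional integral of order 1-γ of x recovers the initial value: lim_{t → a⁺} (1/Γ(1-γ)) ∫_a^t s^{ρ-1} ((t^ρ - s^ρ)/ρ)^{-γ} x(s) ds = c. -/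
open Real Filter Topology intervalIntegral

lemma kat_beta_s5 (p q T : ℝ) (hp : 0 < p) (hq : 0 < q) (hT : 0 < T) :
    ∫ x in (0:ℝ)..T, (T - x) ^ (p - 1) * x ^ (q - 1) =
      T ^ (q + p - 1) * ProbabilityTheory.beta q p := by
  have h := Complex.betaIntegral_scaled (q : ℂ) (p : ℂ) hT
  have hb : Complex.betaIntegral (q : ℂ) (p : ℂ) = ((ProbabilityTheory.beta q p : ℝ) : ℂ) := by
    rw [Complex.betaIntegral_eq_Gamma_mul_div _ _ (by simpa) (by simpa)]
    simp_rw [ProbabilityTheory.beta, ← Complex.ofReal_add q p, Complex.Gamma_ofReal]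
    norm_cast
  rw [hb] at h
  have h2 : ∫ x in (0:ℝ)..T, (x : ℂ) ^ ((q:ℂ) - 1) * ((T : ℂ) - x) ^ ((p:ℂ) - 1)
      = ∫ x in (0:ℝ)..T, (((T - x) ^ (p - 1) * x ^ (q - 1) : ℝ) : ℂ) := by
    apply intervalIntegral.integral_congr
    intro x hx
    rw [Set.uIcc_of_le hT.le] at hx
    simp only
    rw [Complex.ofReal_mul, Complex.ofReal_cpow (sub_nonneg.2 hx.2), Complex.ofReal_cpow hx.1]
    push_cast
    ring
  rw [h2, intervalIntegral.integral_ofReal] at h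
  have h3 : ((T : ℂ) ^ ((q:ℂ) + p - 1)) = ((T ^ (q + p - 1) : ℝ) : ℂ) := by
    rw [Complex.ofReal_cpow hT.le]; push_cast; rfl
  rw [h3] at h
  exact_mod_cast h

lemma kat_pos (ρ a t : ℝ) (hρ : 0 < ρ) (ha : 0 < a) (hat : a < t) :
    0 < (t ^ ρ - a ^ ρ) / ρ :=
  div_pos (sub_pos.2 (Real.rpow_lt_rpow ha.le hat hρ)) hρ

lemma kat_cont (ρ a : ℝ) (hρ : 0 < ρ) : Continuous (fun s : ℝ => (s ^ ρ - a ^ ρ) / ρ) := by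
  have := Real.continuous_rpow_const hρ.le
  fun_prop

lemma kat_image (ρ a t : ℝ) (hρ : 0 < ρ) (ha : 0 < a) (hat : a < t) :
    (fun s : ℝ => (s ^ ρ - a ^ ρ) / ρ) '' Set.Ioo a t = Set.Ioo 0 ((t ^ ρ - a ^ ρ) / ρ) := by
  apply Set.Subset.antisymm
  · rintro _ ⟨s, hs, rfl⟩
    refine ⟨kat_pos ρ a s hρ ha hs.1, ?_⟩
    simp only
    have := Real.rpow_lt_rpow (ha.trans hs.1).le hs.2 hρ
    gcongr
  · have := intermediate_value_Ioo hat.le (kat_cont ρ a hρ).continuousOn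
    simpa using this

lemma kat_int (ρ a p q t : ℝ) (hρ : 0 < ρ) (ha : 0 < a) (hp : 0 < p) (hq : 0 < q) (hat : a < t) :
    ∫ s in a..t, s ^ (ρ - 1) * ((t ^ ρ - s ^ ρ) / ρ) ^ (p - 1) * ((s ^ ρ - a ^ ρ) / ρ) ^ (q - 1) =
      ((t ^ ρ - a ^ ρ) / ρ) ^ (q + p - 1) * ProbabilityTheory.beta q p := by
  have hT := kat_pos ρ a t hρ ha hat
  rw [← kat_beta_s5 p q _ hp hq hT, intervalIntegral.integral_of_le hat.le,
    intervalIntegral.integral_of_le hT.le, MeasureTheory.integral_Ioc_eq_integral_Ioo,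
    MeasureTheory.integral_Ioc_eq_integral_Ioo, ← kat_image ρ a t hρ ha hat,
    MeasureTheory.integral_image_eq_integral_abs_deriv_smul (f' := fun s => s ^ (ρ - 1))
      measurableSet_Ioo]
  · apply MeasureTheory.setIntegral_congr_fun measurableSet_Ioo
    intro s hs
    simp only [smul_eq_mul]
    rw [abs_of_nonneg (Real.rpow_nonneg (ha.trans hs.1).le _), mul_assoc]
    congr 3
    ring
  · intro s hs
    have h := (((Real.hasDerivAt_rpow_const (p := ρ) (x := s)
      (Or.inl (ha.trans hs.1).ne')).sub_const (a ^ ρ)).div_const ρ).hasDerivWithinAt (s := Set.Ioo a t)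
    have e : ρ * s ^ (ρ - 1) / ρ = s ^ (ρ - 1) := by field_simp
    rw [e] at h
    exact h
  · apply StrictMonoOn.injOn
    intro x hx y hy hxy
    have := Real.rpow_lt_rpow (ha.trans hx.1).le hxy hρ
    simp only
    gcongr

lemma kat_ii (ρ a p q t : ℝ) (hρ : 0 < ρ) (ha : 0 < a) (hp : 0 < p) (hq : 0 < q) (hat : a < t) :
    IntervalIntegrable (fun s : ℝ => s ^ (ρ - 1) * ((t ^ ρ - s ^ ρ) / ρ) ^ (p - 1) *
      ((s ^ ρ - a ^ ρ) / ρ) ^ (q - 1)) MeasureTheory.volume a t := by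
  apply intervalIntegral.intervalIntegrable_of_integral_ne_zero
  rw [kat_int ρ a p q t hρ ha hp hq hat]
  exact (mul_pos (Real.rpow_pos_of_pos (kat_pos ρ a t hρ ha hat) _)
    (ProbabilityTheory.beta_pos hq hp)).ne'

lemma kat_bound (ρ a α γ M s : ℝ) (hρ : 0 < ρ) (ha : 0 < a) (hα : 0 < α) (hγ : 0 < γ)
    (g : ℝ → ℝ) (has : a < s)
    (hgb : ∀ t ∈ Set.Ioi a, |((t ^ ρ - a ^ ρ) / ρ) ^ (1 - γ) * g t| ≤ M) :
    |∫ u in a..s, u ^ (ρ - 1) * ((s ^ ρ - u ^ ρ) / ρ) ^ (α - 1) * g u| ≤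
      M * (((s ^ ρ - a ^ ρ) / ρ) ^ (γ + α - 1) * ProbabilityTheory.beta γ α) := by
  rw [← kat_int ρ a α γ s hρ ha hα hγ has, ← intervalIntegral.integral_const_mul]
  rw [← Real.norm_eq_abs]
  refine intervalIntegral.norm_integral_le_of_norm_le has.le (Eventually.of_forall ?_)
    ((kat_ii ρ a α γ s hρ ha hα hγ has).const_mul M)
  intro u hu
  have hφ := kat_pos ρ a u hρ ha hu.1
  have h1 : |g u| ≤ M * ((u ^ ρ - a ^ ρ) / ρ) ^ (γ - 1) := by
    have := hgb u hu.1
    rw [abs_mul, abs_of_pos (Real.rpow_pos_of_pos hφ _), show 1 - γ = -(γ - 1) by ring,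
      Real.rpow_neg hφ.le, inv_mul_eq_div, div_le_iff₀ (Real.rpow_pos_of_pos hφ _)] at this
    exact this
  have hk : 0 ≤ u ^ (ρ - 1) * ((s ^ ρ - u ^ ρ) / ρ) ^ (α - 1) := by
    have hu0 := ha.trans hu.1
    have : u ^ ρ ≤ s ^ ρ := Real.rpow_le_rpow hu0.le hu.2 hρ.le
    exact mul_nonneg (Real.rpow_nonneg hu0.le _)
      (Real.rpow_nonneg (div_nonneg (sub_nonneg.2 this) hρ.le) _)
  rw [Real.norm_eq_abs, abs_mul, abs_of_nonneg hk]
  calc _ ≤ _ := mul_le_mul_of_nonneg_left h1 hk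
    _ = _ := by ring

lemma kat_meas (ρ a α : ℝ) (g : ℝ → ℝ) (hg : ContinuousOn g (Set.Ioi a)) :
    ∃ H : ℝ → ℝ, Measurable H ∧ ∀ s, a < s →
      H s = ∫ u in a..s, u ^ (ρ - 1) * ((s ^ ρ - u ^ ρ) / ρ) ^ (α - 1) * g u := by
  have hgm : Measurable (Set.indicator (Set.Ioi a) g) := by
    classical
    rw [← Set.piecewise_eq_indicator]
    exact hg.measurable_piecewise continuousOn_const measurableSet_Ioi
  let S : Set (ℝ × ℝ) := {x | a < x.2 ∧ x.2 ≤ x.1}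
  have hS : MeasurableSet S :=
    (measurableSet_lt measurable_const measurable_snd).inter
      (measurableSet_le measurable_snd measurable_fst)
  let F : ℝ × ℝ → ℝ := S.indicator fun x =>
    x.2 ^ (ρ - 1) * ((x.1 ^ ρ - x.2 ^ ρ) / ρ) ^ (α - 1) * (Set.indicator (Set.Ioi a) g x.2)
  have hF : Measurable F := by
    apply Measurable.indicator _ hS
    have : Measurable (fun x : ℝ × ℝ => Set.indicator (Set.Ioi a) g x.2) :=
      hgm.comp measurable_snd
    refine Measurable.mul ?_ this
    fun_prop
  refine ⟨fun s => ∫ u, F (s, u), ?_, ?_⟩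
  · exact (hF.stronglyMeasurable.integral_prod_right').measurable
  · intro s hs
    rw [intervalIntegral.integral_of_le hs.le, ← MeasureTheory.integral_indicator measurableSet_Ioc]
    refine MeasureTheory.integral_congr_ae (Eventually.of_forall fun u => ?_)
    simp only [F, S, Set.indicator_apply, Set.mem_setOf_eq, Set.mem_Ioc, Set.mem_Ioi]
    by_cases h : a < u ∧ u ≤ s
    · simp [h]
    · simp [h]

/-- The Katugampola fractional integral of order `1-γ` of
`x(t) = (c/Γ(γ)) ((t^ρ-a^ρ)/ρ)^(γ-1) + (ρI_{a+}^α g)(t)` recovers the initial value `c`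
as `t → a⁺`. -/
theorem katugampola_initial_value_recovery
    (α β ρ a γ c : ℝ) (hα : 0 < α) (hα1 : α < 1) (hβ : 0 ≤ β) (hβ1 : β < 1)
    (hρ : 0 < ρ) (ha : 0 < a) (hγ : γ = α + β * (1 - α))
    (g : ℝ → ℝ) (hg : ContinuousOn g (Set.Ioi a))
    (hgb : ∃ M : ℝ, ∀ t ∈ Set.Ioi a, |((t ^ ρ - a ^ ρ) / ρ) ^ (1 - γ) * g t| ≤ M) :
    Tendsto (fun t : ℝ =>
        (1 / Real.Gamma (1 - γ)) * ∫ s in a..t, s ^ (ρ - 1) * ((t ^ ρ - s ^ ρ) / ρ) ^ (-γ) *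
          ((c / Real.Gamma γ) * ((s ^ ρ - a ^ ρ) / ρ) ^ (γ - 1) +
            (1 / Real.Gamma α) * ∫ u in a..s, u ^ (ρ - 1) * ((s ^ ρ - u ^ ρ) / ρ) ^ (α - 1) * g u))
      (𝓝[>] a) (𝓝 c) := by
  have hγ0 : 0 < γ := by rw [hγ]; nlinarith [mul_nonneg hβ (sub_nonneg.2 hα1.le)]
  have hγ1 : γ < 1 := by rw [hγ]; nlinarith [mul_pos (sub_pos.2 hβ1) (sub_pos.2 hα1)]
  clear hγ
  obtain ⟨M, hM⟩ := hgb
  obtain ⟨H, hHm, hH⟩ := kat_meas ρ a α g hg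
  have hΓ1 := Real.Gamma_pos_of_pos (sub_pos.2 hγ1)
  have hΓ := Real.Gamma_pos_of_pos hγ0
  have e1 : -γ = (1 - γ) - 1 := by ring
  have hp : 0 < 1 - γ := sub_pos.2 hγ1
  have hq : 0 < γ + α := by positivity
  set K : ℝ := |1 / Real.Gamma α| * (M * ProbabilityTheory.beta γ α) with hK
  set R : ℝ → ℝ := fun t => ∫ s in a..t, s ^ (ρ - 1) * ((t ^ ρ - s ^ ρ) / ρ) ^ (-γ) *
    (1 / Real.Gamma α * H s) with hR
  have hb : ∀ t, a < t → ∀ s ∈ Set.Ioc a t,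
      ‖s ^ (ρ - 1) * ((t ^ ρ - s ^ ρ) / ρ) ^ (-γ) * (1 / Real.Gamma α * H s)‖ ≤
      K * (s ^ (ρ - 1) * ((t ^ ρ - s ^ ρ) / ρ) ^ ((1 - γ) - 1) *
        ((s ^ ρ - a ^ ρ) / ρ) ^ (γ + α - 1)) := by
    intro t ht s hs
    have h1 := kat_bound ρ a α γ M s hρ ha hα hγ0 g hs.1 hM
    rw [← hH s hs.1] at h1
    have hk : 0 ≤ s ^ (ρ - 1) * ((t ^ ρ - s ^ ρ) / ρ) ^ (-γ) := by
      have hu0 := ha.trans hs.1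
      have : s ^ ρ ≤ t ^ ρ := Real.rpow_le_rpow hu0.le hs.2 hρ.le
      exact mul_nonneg (Real.rpow_nonneg hu0.le _)
        (Real.rpow_nonneg (div_nonneg (sub_nonneg.2 this) hρ.le) _)
    rw [← e1, Real.norm_eq_abs, abs_mul, abs_of_nonneg hk, abs_mul]
    calc _ ≤ _ := mul_le_mul_of_nonneg_left (mul_le_mul_of_nonneg_left h1 (abs_nonneg _)) hk
      _ = _ := by rw [hK]; ring
  have hKi := fun t (ht : a < t) => (kat_ii ρ a (1 - γ) (γ + α) t hρ ha hp hq ht).const_mul K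
  have hRi : ∀ t, a < t → IntervalIntegrable (fun s => s ^ (ρ - 1) *
      ((t ^ ρ - s ^ ρ) / ρ) ^ (-γ) * (1 / Real.Gamma α * H s)) MeasureTheory.volume a t := by
    intro t ht
    refine (hKi t ht).mono_fun' ?_ ?_
    · exact (Measurable.aestronglyMeasurable (by fun_prop))
    · rw [Set.uIoc_of_le ht.le]
      exact (MeasureTheory.ae_restrict_iff' measurableSet_Ioc).2 (Eventually.of_forall (hb t ht))
  have hRb : ∀ t, a < t → ‖R t‖ ≤ K * (((t ^ ρ - a ^ ρ) / ρ) ^ α *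
      ProbabilityTheory.beta (γ + α) (1 - γ)) := by
    intro t ht
    have := intervalIntegral.norm_integral_le_of_norm_le ht.le
      (Eventually.of_forall (hb t ht)) (hKi t ht)
    rw [intervalIntegral.integral_const_mul, kat_int ρ a (1 - γ) (γ + α) t hρ ha hp hq ht,
      show γ + α + (1 - γ) - 1 = α by ring] at this
    exact this
  have hlim : Tendsto (fun t : ℝ => K * (((t ^ ρ - a ^ ρ) / ρ) ^ α *
      ProbabilityTheory.beta (γ + α) (1 - γ))) (𝓝[>] a) (𝓝 0) := by
    have hc : Continuous (fun t : ℝ => K * (((t ^ ρ - a ^ ρ) / ρ) ^ α *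
      ProbabilityTheory.beta (γ + α) (1 - γ))) :=
      continuous_const.mul (((kat_cont ρ a hρ).rpow_const (fun _ => Or.inr hα.le)).mul
        continuous_const)
    have := (hc.tendsto a).mono_left (nhdsWithin_le_nhds (s := Set.Ioi a))
    simpa [Real.zero_rpow hα.ne'] using this
  have hR0 : Tendsto R (𝓝[>] a) (𝓝 0) :=
    squeeze_zero_norm' (eventually_nhdsWithin_of_forall hRb) hlim
  have hfin : Tendsto (fun t => c + (1 / Real.Gamma (1 - γ)) * R t) (𝓝[>] a) (𝓝 c) := by
    simpa using (hR0.const_mul (1 / Real.Gamma (1 - γ))).const_add c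
  refine hfin.congr' (eventually_nhdsWithin_of_forall ?_)
  intro t ht
  have ht : a < t := ht
  have hsplit : (∫ s in a..t, s ^ (ρ - 1) * ((t ^ ρ - s ^ ρ) / ρ) ^ (-γ) *
          ((c / Real.Gamma γ) * ((s ^ ρ - a ^ ρ) / ρ) ^ (γ - 1) +
            (1 / Real.Gamma α) *
              ∫ u in a..s, u ^ (ρ - 1) * ((s ^ ρ - u ^ ρ) / ρ) ^ (α - 1) * g u)) =
      (∫ s in a..t, (c / Real.Gamma γ) * (s ^ (ρ - 1) * ((t ^ ρ - s ^ ρ) / ρ) ^ ((1 - γ) - 1) *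
        ((s ^ ρ - a ^ ρ) / ρ) ^ (γ - 1))) + R t := by
    rw [hR, ← intervalIntegral.integral_add
      ((kat_ii ρ a (1 - γ) γ t hρ ha hp hγ0 ht).const_mul _) (hRi t ht)]
    rw [intervalIntegral.integral_of_le ht.le, intervalIntegral.integral_of_le ht.le]
    apply MeasureTheory.setIntegral_congr_fun measurableSet_Ioc
    intro s hs
    simp only
    rw [← hH s hs.1, ← e1]
    ring
  simp only
  rw [hsplit, intervalIntegral.integral_const_mul, kat_int ρ a (1 - γ) γ t hρ ha hp hγ0 ht,
    show γ + (1 - γ) - 1 = 0 by ring, Real.rpow_zero, ProbabilityTheory.beta,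
    show γ + (1 - γ) = 1 by ring, Real.Gamma_one]
  field_simp
end

section
/- Let 0 < α < 1, 0 ≤ β ≤ 1, ρ > 0, a > 0, γ = α + β(1-α), and c₁ ∈ ℝ. Let f : [a,∞) × ℝ × ℝ → ℝ and let p : [a,∞) → [0,∞) be continuous with |f(t,x,y)| ≤ p(t)/(1 + |x| + |y|) for almost every t ≥ a and all x, y ∈ ℝ, and suppose lim_{t→∞} ((t^ρ - a^ρ)/ρ)^{1-γ} (ρI_{a+}^α p)(t) = 0. Let (x, g) and (x₀, g₀) be two solutions of the integral formulation, i.e. g, g₀ ∈ BC_{γ,ρ} with g(t) = f(t, x(t), g(t)) and g₀(t) = f(t, x₀(t), g₀(t)) for all t > a, where x(t) = (c₁/Γ(γ)) ((t^ρ - a^ρ)/ρ)^{γ-1} + (ρI_{a+}^α g)(t) and x₀(t) = (c₁/Γ(γ)) ((t^ρ - a^ρ)/ρ)^{γ-1} + (ρI_{a+}^α g₀)(t). Then lim_{t→∞} (x(t) - x₀(t)) = 0; that is, the solutions are attractive. -/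
open Real Filter Topology intervalIntegral MeasureTheory

/-- The Katugampola fractional integral of order `α` (base point `a`, parameter `ρ`). -/
noncomputable def katI (ρ a α : ℝ) (g : ℝ → ℝ) (t : ℝ) : ℝ :=
  (1 / Real.Gamma α) * ∫ s in a..t, s ^ (ρ - 1) * ((t ^ ρ - s ^ ρ) / ρ) ^ (α - 1) * g s

theorem katI_kernel_intervalIntegrable (ρ a α t : ℝ) (hα : 0 < α) (hρ : 0 < ρ) (ha : 0 < a)
    (hat : a ≤ t) :
    IntervalIntegrable (fun s : ℝ => s ^ (ρ - 1) * ((t ^ ρ - s ^ ρ) / ρ) ^ (α - 1))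
      volume a t := by
  have hpos : ∀ s ∈ Set.Ioo a t, 0 < (t ^ ρ - s ^ ρ) / ρ := by
    intro s hs
    have := Real.rpow_lt_rpow (ha.le.trans hs.1.le) hs.2 hρ
    exact div_pos (by linarith) hρ
  refine intervalIntegrable_deriv_of_nonneg
    (g := fun s : ℝ => -(((t ^ ρ - s ^ ρ) / ρ) ^ α / α)) ?_ ?_ ?_
  · have h1 : Continuous fun s : ℝ => s ^ ρ := Real.continuous_rpow_const hρ.le
    have h2 : Continuous fun s : ℝ => ((t ^ ρ - s ^ ρ) / ρ) ^ α :=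
      (Real.continuous_rpow_const hα.le).comp ((continuous_const.sub h1).div_const ρ)
    exact (h2.div_const α).neg.continuousOn
  · intro s hs
    rw [min_eq_left hat, max_eq_right hat] at hs
    have hs0 : 0 < s := ha.trans hs.1
    have h1 : HasDerivAt (fun s : ℝ => s ^ ρ) (ρ * s ^ (ρ - 1)) s :=
      Real.hasDerivAt_rpow_const (Or.inl hs0.ne')
    have h2 := (((h1.const_sub (t ^ ρ)).div_const ρ).rpow_const (p := α)
      (Or.inl (hpos s hs).ne')).div_const α |>.neg
    refine h2.congr_deriv ?_
    field_simp
  · intro s hs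
    rw [min_eq_left hat, max_eq_right hat] at hs
    exact mul_nonneg (Real.rpow_nonneg (ha.trans hs.1).le _)
      (Real.rpow_nonneg (hpos s hs).le _)

theorem abs_katI_le (ρ a α t : ℝ) (hα : 0 < α) (hρ : 0 < ρ) (ha : 0 < a)
    (hat : a ≤ t) (p g : ℝ → ℝ) (hpc : ContinuousOn p (Set.Ici a))
    (hgp : ∀ᵐ s ∂(volume : Measure ℝ), a < s → |g s| ≤ p s) :
    |katI ρ a α g t| ≤ katI ρ a α p t := by
  unfold katI
  have hG : 0 ≤ 1 / Real.Gamma α := (div_pos one_pos (Real.Gamma_pos_of_pos hα)).le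
  rw [abs_mul, abs_of_nonneg hG]
  refine mul_le_mul_of_nonneg_left ?_ hG
  rw [← Real.norm_eq_abs]
  refine intervalIntegral.norm_integral_le_of_norm_le hat ?_ ?_
  · filter_upwards [hgp] with s hs hst
    have h0 : 0 < s := ha.trans hst.1
    have h1 : s ^ ρ ≤ t ^ ρ := Real.rpow_le_rpow h0.le hst.2 hρ.le
    have h2 : 0 ≤ s ^ (ρ - 1) * ((t ^ ρ - s ^ ρ) / ρ) ^ (α - 1) :=
      mul_nonneg (Real.rpow_nonneg h0.le _)
        (Real.rpow_nonneg (div_nonneg (by linarith) hρ.le) _)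
    rw [Real.norm_eq_abs, abs_mul, abs_of_nonneg h2]
    exact mul_le_mul_of_nonneg_left (hs hst.1) h2
  · refine (katI_kernel_intervalIntegrable ρ a α t hα hρ ha hat).mul_continuousOn ?_
    refine hpc.mono ?_
    rw [Set.uIcc_of_le hat]
    exact Set.Icc_subset_Ici_self

/-- Attractivity of solutions: any two solutions of the integral formulation of the
implicit IVP approach each other at infinity. -/
theorem solutions_attractive
    (α β ρ a γ c₁ : ℝ) (hα : 0 < α) (hα1 : α < 1) (hβ : 0 ≤ β) (hβ1 : β ≤ 1)
    (hρ : 0 < ρ) (ha : 0 < a) (hγ : γ = α + β * (1 - α))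
    (f : ℝ → ℝ → ℝ → ℝ)
    (p : ℝ → ℝ) (hpc : ContinuousOn p (Set.Ici a)) (hp0 : ∀ t ∈ Set.Ici a, 0 ≤ p t)
    (hfb : ∀ᵐ t ∂(volume.restrict (Set.Ici a)), ∀ x y : ℝ,
      |f t x y| ≤ p t / (1 + |x| + |y|))
    (hlim : Tendsto (fun t => ((t ^ ρ - a ^ ρ) / ρ) ^ (1 - γ) * katI ρ a α p t)
      atTop (𝓝 0))
    (x g x₀ g₀ : ℝ → ℝ)
    -- `g, g₀ ∈ BC_{γ,ρ}`
    (hgC : ContinuousOn (fun t => ((t ^ ρ - a ^ ρ) / ρ) ^ (1 - γ) * g t) (Set.Ioi a))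
    (hgB : ∃ M : ℝ, ∀ t ∈ Set.Ioi a, |((t ^ ρ - a ^ ρ) / ρ) ^ (1 - γ) * g t| ≤ M)
    (hg₀C : ContinuousOn (fun t => ((t ^ ρ - a ^ ρ) / ρ) ^ (1 - γ) * g₀ t) (Set.Ioi a))
    (hg₀B : ∃ M : ℝ, ∀ t ∈ Set.Ioi a, |((t ^ ρ - a ^ ρ) / ρ) ^ (1 - γ) * g₀ t| ≤ M)
    -- `x` and `x₀` are given by the integral formulas
    (hx : ∀ t ∈ Set.Ioi a,
      x t = (c₁ / Real.Gamma γ) * ((t ^ ρ - a ^ ρ) / ρ) ^ (γ - 1) + katI ρ a α g t)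
    (hx₀ : ∀ t ∈ Set.Ioi a,
      x₀ t = (c₁ / Real.Gamma γ) * ((t ^ ρ - a ^ ρ) / ρ) ^ (γ - 1) + katI ρ a α g₀ t)
    -- the fixed point equations
    (hgf : ∀ t ∈ Set.Ioi a, g t = f t (x t) (g t))
    (hg₀f : ∀ t ∈ Set.Ioi a, g₀ t = f t (x₀ t) (g₀ t)) :
    Tendsto (fun t => x t - x₀ t) atTop (𝓝 0) := by
  have hfb' := (ae_restrict_iff' measurableSet_Ici).1 hfb
  have key : ∀ y h : ℝ → ℝ, (∀ t ∈ Set.Ioi a, h t = f t (y t) (h t)) →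
      ∀ᵐ s ∂(volume : Measure ℝ), a < s → |h s| ≤ p s := by
    intro y h hh
    filter_upwards [hfb'] with s hs has
    have h1 := hs has.le (y s) (h s)
    rw [← hh s has] at h1
    refine h1.trans (div_le_self (hp0 s has.le) ?_)
    have := abs_nonneg (y s)
    have := abs_nonneg (h s)
    linarith
  have hk := key x g hgf
  have hk₀ := key x₀ g₀ hg₀f
  have hγ1 : 0 ≤ 1 - γ := by
    have : 0 ≤ (1 - α) * (1 - β) := mul_nonneg (by linarith) (by linarith)
    rw [hγ]; linarith
  have hw : ∀ᶠ t : ℝ in atTop, 1 ≤ (t ^ ρ - a ^ ρ) / ρ := by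
    filter_upwards [(tendsto_rpow_atTop hρ).eventually_ge_atTop (a ^ ρ + ρ)] with t ht
    rw [le_div_iff₀ hρ]; linarith
  have hlim2 := hlim.const_mul 2
  rw [mul_zero] at hlim2
  refine squeeze_zero_norm' ?_ hlim2
  filter_upwards [hw, eventually_gt_atTop a] with t ht hat
  have b1 := abs_katI_le ρ a α t hα hρ ha hat.le p g hpc hk
  have b2 := abs_katI_le ρ a α t hα hρ ha hat.le p g₀ hpc hk₀
  have h0 : 0 ≤ katI ρ a α p t := (abs_nonneg _).trans b1
  have h1 : 1 ≤ ((t ^ ρ - a ^ ρ) / ρ) ^ (1 - γ) := Real.one_le_rpow ht hγ1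
  have h2 := mul_le_mul_of_nonneg_right h1 h0
  rw [hx t hat, hx₀ t hat, add_sub_add_left_eq_sub, Real.norm_eq_abs]
  have h3 := abs_sub (katI ρ a α g t) (katI ρ a α g₀ t)
  linarith
end

section
/- Let 0 < α < 1, 0 ≤ β < 1, ρ > 0, a > 0, γ = α + β(1-α) (so γ < 1), and c₁ ∈ ℝ. Let g : (a,∞) → ℝ be measurable and let p : [a,∞) → [0,∞) be continuous with |g(t)| ≤ p(t) for almost every t > a, and suppose lim_{t→∞} ((t^ρ - a^ρ)/ρ)^{1-γ} (ρI_{a+}^α p)(t) = 0. Define x(t) = (c₁/Γ(γ)) ((t^ρ - a^ρ)/ρ)^{γ-1} + (ρI_{a+}^α g)(t) for t > a. Then lim_{t→∞} x(t) = 0. -/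
open Real Filter Topology intervalIntegral MeasureTheory

lemma kernel_intInt (ρ a α t : ℝ) (hα : 0 < α) (hρ : 0 < ρ) (ha : 0 < a) (hat : a < t) :
    IntervalIntegrable (fun s => s ^ (ρ - 1) * ((t ^ ρ - s ^ ρ) / ρ) ^ (α - 1)) volume a t := by
  have hpos : ∀ s ∈ Set.Ioo a t, 0 < (t ^ ρ - s ^ ρ) / ρ := by
    intro s hs
    have := Real.rpow_lt_rpow (ha.trans hs.1).le hs.2 hρ
    exact div_pos (by linarith) hρ
  apply intervalIntegral.intervalIntegrable_deriv_of_nonneg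
    (g := fun s => -(((t ^ ρ - s ^ ρ) / ρ) ^ α / α))
  · apply ContinuousOn.neg
    apply ContinuousOn.div_const
    apply ContinuousOn.rpow_const _ (fun _ _ => Or.inr hα.le)
    apply ContinuousOn.div_const
    exact continuousOn_const.sub (continuousOn_id.rpow_const (fun _ _ => Or.inr hρ.le))
  · intro s hs
    rw [min_eq_left hat.le, max_eq_right hat.le] at hs
    have h0 := hpos s hs
    have h1 : HasDerivAt (fun s : ℝ => s ^ ρ) (ρ * s ^ (ρ - 1)) s :=
      Real.hasDerivAt_rpow_const (Or.inl (ha.trans hs.1).ne')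
    have h2 := (((h1.const_sub (t ^ ρ)).div_const ρ).rpow_const (p := α) (Or.inl h0.ne')).div_const α
    refine h2.neg.congr_deriv ?_
    have e : -(ρ * s ^ (ρ - 1)) / ρ = -s ^ (ρ - 1) := by
      rw [neg_div, mul_div_cancel_left₀ _ hρ.ne']
    rw [e]
    generalize ((t ^ ρ - s ^ ρ) / ρ) ^ (α - 1) = w
    field_simp
  · intro s hs
    rw [min_eq_left hat.le, max_eq_right hat.le] at hs
    exact mul_nonneg (Real.rpow_nonneg (ha.trans hs.1).le _) (Real.rpow_nonneg (hpos s hs).le _)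

lemma katI_abs_le (ρ a α t : ℝ) (hα : 0 < α) (hρ : 0 < ρ) (ha : 0 < a) (hat : a < t)
    (g p : ℝ → ℝ) (hpc : ContinuousOn p (Set.Ici a))
    (hgp : ∀ᵐ t ∂(volume.restrict (Set.Ioi a)), |g t| ≤ p t) :
    |katI ρ a α g t| ≤ katI ρ a α p t := by
  have hG : 0 < 1 / Real.Gamma α := by have := Real.Gamma_pos_of_pos hα; positivity
  unfold katI
  rw [abs_mul, abs_of_pos hG]
  apply mul_le_mul_of_nonneg_left _ hG.le
  rw [← Real.norm_eq_abs]
  apply intervalIntegral.norm_integral_le_of_norm_le hat.le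
  · rw [ae_restrict_iff' measurableSet_Ioi] at hgp
    filter_upwards [hgp] with s hs hst
    have h1 : 0 ≤ s ^ (ρ - 1) := Real.rpow_nonneg (ha.trans hst.1).le _
    have h3 := Real.rpow_le_rpow (ha.trans hst.1).le hst.2 hρ.le
    have h2 : 0 ≤ ((t ^ ρ - s ^ ρ) / ρ) ^ (α - 1) :=
      Real.rpow_nonneg (div_nonneg (by linarith) hρ.le) _
    rw [Real.norm_eq_abs, abs_mul, abs_of_nonneg (mul_nonneg h1 h2)]
    exact mul_le_mul_of_nonneg_left (hs hst.1) (mul_nonneg h1 h2)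
  · apply (kernel_intInt ρ a α t hα hρ ha hat).mul_continuousOn
    apply hpc.mono
    rw [Set.uIcc_of_le hat.le]
    exact Set.Icc_subset_Ici_self

/-- Solutions of the integral equation tend to zero at infinity. -/
theorem solution_tendsto_zero_atTop
    (α β ρ a γ c₁ : ℝ) (hα : 0 < α) (hα1 : α < 1) (hβ : 0 ≤ β) (hβ1 : β < 1)
    (hρ : 0 < ρ) (ha : 0 < a) (hγ : γ = α + β * (1 - α))
    (g : ℝ → ℝ) (hgm : Measurable g)
    (p : ℝ → ℝ) (hpc : ContinuousOn p (Set.Ici a)) (hp0 : ∀ t ∈ Set.Ici a, 0 ≤ p t)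
    (hgp : ∀ᵐ t ∂(volume.restrict (Set.Ioi a)), |g t| ≤ p t)
    (hlim : Tendsto (fun t => ((t ^ ρ - a ^ ρ) / ρ) ^ (1 - γ) * katI ρ a α p t)
      atTop (𝓝 0))
    (x : ℝ → ℝ)
    (hx : ∀ t ∈ Set.Ioi a,
      x t = (c₁ / Real.Gamma γ) * ((t ^ ρ - a ^ ρ) / ρ) ^ (γ - 1) + katI ρ a α g t) :
    Tendsto x atTop (𝓝 0) := by
  have hγ1 : 0 < 1 - γ := by nlinarith
  have hu : Tendsto (fun t : ℝ => (t ^ ρ - a ^ ρ) / ρ) atTop atTop := by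
    apply Tendsto.atTop_div_const hρ
    exact tendsto_atTop_add_const_right _ _ (tendsto_rpow_atTop hρ)
  have hk : Tendsto (fun t : ℝ => ((t ^ ρ - a ^ ρ) / ρ) ^ (γ - 1)) atTop (𝓝 0) := by
    have := (tendsto_rpow_neg_atTop hγ1).comp hu
    rwa [neg_sub] at this
  have hp : Tendsto (fun t => katI ρ a α p t) atTop (𝓝 0) := by
    have h := hk.mul hlim
    rw [mul_zero] at h
    refine h.congr' ?_
    filter_upwards [hu.eventually_gt_atTop 0] with t ht
    rw [← mul_assoc, ← Real.rpow_add ht]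
    simp
  have hg : Tendsto (fun t => katI ρ a α g t) atTop (𝓝 0) := by
    apply squeeze_zero_norm' _ hp
    filter_upwards [eventually_gt_atTop a] with t ht
    exact katI_abs_le ρ a α t hα hρ ha ht g p hpc hgp
  have h := (hk.const_mul (c₁ / Real.Gamma γ)).add hg
  rw [mul_zero, add_zero] at h
  refine h.congr' ?_
  filter_upwards [eventually_gt_atTop a] with t ht
  exact (hx t ht).symm
end

section
/- Let 0 < a < b, 0 < α < 1, 0 ≤ β ≤ 1, ρ > 0, γ = α + β(1-α), and c₂ ∈ ℝ. Let f : [a,b] × ℝ → ℝ be such that t ↦ f(t,x) is measurable for each x ∈ ℝ, x ↦ f(t,x) is continuous for almost every t ∈ [a,b], and there exists a continuous function p : [a,b] → [0,∞) with |f(t,x)| ≤ p(t)|x|/(1 + |x|) for almost every t ∈ [a,b] and all x ∈ ℝ. Then there exists a function x : (a,b] → ℝ with t ↦ ((t^ρ - a^ρ)/ρ)^{1-γ} x(t) extending continuously to [a,b], satisfying for every t ∈ (a,b]: x(t) = (c₂/Γ(γ)) ((t^ρ - a^ρ)/ρ)^{γ-1} + (1/Γ(α)) ∫_a^t s^{ρ-1}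 ((t^ρ - s^ρ)/ρ)^{α-1} f(s, x(s)) ds. -/
open Real Filter Topology intervalIntegral MeasureTheory

/-- Membership in the weighted space `C_{γ,ρ}([a,b])`: the weighted function
`t ↦ ((t^ρ-a^ρ)/ρ)^(1-γ) x(t)` extends continuously to `[a,b]`. -/
def MemCgr (ρ a b γ : ℝ) (x : ℝ → ℝ) : Prop :=
  ∃ X : ℝ → ℝ, ContinuousOn X (Set.Icc a b) ∧
    ∀ t ∈ Set.Ioc a b, X t = ((t ^ ρ - a ^ ρ) / ρ) ^ (1 - γ) * x t

noncomputable def kker (ρ α t s : ℝ) : ℝ := s ^ (ρ - 1) * ((t ^ ρ - s ^ ρ) / ρ) ^ (α - 1)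

lemma kker_nonneg {ρ α t s : ℝ} (hρ : 0 < ρ) (hs : 0 < s) (hst : s ≤ t) : 0 ≤ kker ρ α t s := by
  unfold kker
  have : s ^ ρ ≤ t ^ ρ := Real.rpow_le_rpow hs.le hst hρ.le
  have h2 : 0 ≤ (t ^ ρ - s ^ ρ) / ρ := div_nonneg (by linarith) hρ.le
  positivity

lemma kker_int {ρ α c t : ℝ} (hρ : 0 < ρ) (hα : 0 < α) (hc : 0 < c) (hct : c ≤ t) :
    IntervalIntegrable (kker ρ α t) volume c t ∧
      ∫ s in c..t, kker ρ α t s = ((t ^ ρ - c ^ ρ) / ρ) ^ α / α := by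
  have hcont : ContinuousOn (fun s => -(((t ^ ρ - s ^ ρ) / ρ) ^ α / α)) (Set.Icc c t) := by
    apply Continuous.continuousOn
    apply Continuous.neg
    apply Continuous.div_const
    apply Continuous.rpow_const _ (fun _ => Or.inr hα.le)
    exact (continuous_const.sub (Real.continuous_rpow_const hρ.le)).div_const _
  have hder : ∀ s ∈ Set.Ioo c t,
      HasDerivAt (fun s => -(((t ^ ρ - s ^ ρ) / ρ) ^ α / α)) (kker ρ α t s) s := by
    intro s hs
    have hs0 : 0 < s := hc.trans hs.1
    have hlt : s ^ ρ < t ^ ρ := Real.rpow_lt_rpow hs0.le hs.2 hρ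
    have hpos : 0 < (t ^ ρ - s ^ ρ) / ρ := div_pos (by linarith) hρ
    have h1 : HasDerivAt (fun s : ℝ => (t ^ ρ - s ^ ρ) / ρ) (-(ρ * s ^ (ρ - 1)) / ρ) s := by
      have := ((Real.hasDerivAt_rpow_const (x := s) (p := ρ) (Or.inl hs0.ne')).const_sub (t ^ ρ)).div_const ρ
      exact this
    have h2 := ((h1.rpow_const (p := α) (Or.inl hpos.ne')).div_const α).neg
    refine h2.congr_deriv ?_
    unfold kker
    field_simp
  have hnn : ∀ s ∈ Set.Ioo c t, 0 ≤ kker ρ α t s := fun s hs =>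
    kker_nonneg hρ (hc.trans hs.1) hs.2.le
  have hi : IntervalIntegrable (kker ρ α t) volume c t := by
    rw [intervalIntegrable_iff_integrableOn_Ioc_of_le hct]
    exact integrableOn_deriv_of_nonneg hcont hder hnn
  refine ⟨hi, ?_⟩
  rw [integral_eq_sub_of_hasDerivAt_of_le hct hcont hder hi]
  simp [Real.zero_rpow hα.ne']

lemma kker_mul_int {ρ α c t M : ℝ} (hρ : 0 < ρ) (hα : 0 < α) (hc : 0 < c) (hct : c ≤ t)
    {v : ℝ → ℝ} (hv : Measurable v) (hM : ∀ s, |v s| ≤ M) :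
    IntervalIntegrable (fun s => kker ρ α t s * v s) volume c t := by
  have := (kker_int hρ hα hc hct).1
  rw [intervalIntegrable_iff_integrableOn_Ioc_of_le hct] at this ⊢
  exact Integrable.mul_bdd (c := M) this hv.aestronglyMeasurable (ae_of_all _ hM)

lemma kker_diff {ρ α a t₁ t₂ M : ℝ} (hρ : 0 < ρ) (hα : 0 < α) (hα1 : α < 1) (ha : 0 < a)
    (h1 : a ≤ t₁) (h12 : t₁ ≤ t₂) {v : ℝ → ℝ} (hv : Measurable v) (hM : ∀ s, |v s| ≤ M) :
    |(∫ s in a..t₂, kker ρ α t₂ s * v s) - ∫ s in a..t₁, kker ρ α t₁ s * v s| ≤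
      2 * M / α * ((t₂ ^ ρ - t₁ ^ ρ) / ρ) ^ α := by
  have h1' : 0 < t₁ := ha.trans_le h1
  have hM0 : 0 ≤ M := (abs_nonneg _).trans (hM 0)
  have hu1 : Set.uIcc a t₁ ⊆ Set.uIcc a t₂ := by
    rw [Set.uIcc_of_le h1, Set.uIcc_of_le (h1.trans h12)]; exact Set.Icc_subset_Icc_right h12
  obtain ⟨i1, e1⟩ := kker_int hρ hα ha h1
  obtain ⟨i2, e2⟩ := kker_int hρ hα ha (h1.trans h12)
  obtain ⟨i3, e3⟩ := kker_int hρ hα h1' h12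
  have j1 := kker_mul_int hρ hα ha h1 hv hM
  have j2 := kker_mul_int hρ hα ha (h1.trans h12) hv hM
  have j3 := kker_mul_int hρ hα h1' h12 hv hM
  have i4 := i2.mono_set hu1
  have j4 := j2.mono_set hu1
  have e4 := integral_add_adjacent_intervals i4 i3
  have f4 := integral_add_adjacent_intervals j4 j3
  have b1 : |(∫ s in a..t₁, (kker ρ α t₂ s * v s - kker ρ α t₁ s * v s))| ≤
      ∫ s in a..t₁, M * (kker ρ α t₁ s - kker ρ α t₂ s) := by
    rw [← Real.norm_eq_abs]
    apply intervalIntegral.norm_integral_le_of_norm_le h1 _ ((i1.sub i4).const_mul M)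
    have : ∀ᵐ s : ℝ, s ≠ t₁ := by simp [ae_iff]
    filter_upwards [this] with s hs hs'
    have hs0 : 0 < s := ha.trans hs'.1
    have hst : s < t₁ := lt_of_le_of_ne hs'.2 hs
    have q1 : s ^ ρ < t₁ ^ ρ := Real.rpow_lt_rpow hs0.le hst hρ
    have q2 : t₁ ^ ρ ≤ t₂ ^ ρ := Real.rpow_le_rpow h1'.le h12 hρ.le
    have : kker ρ α t₂ s ≤ kker ρ α t₁ s := by
      unfold kker
      apply mul_le_mul_of_nonneg_left _ (Real.rpow_nonneg hs0.le _)
      apply Real.rpow_le_rpow_of_nonpos (div_pos (by linarith) hρ) _ (by linarith)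
      gcongr
    rw [← sub_mul, norm_mul, Real.norm_eq_abs, Real.norm_eq_abs, abs_sub_comm, abs_of_nonneg (sub_nonneg.2 this), mul_comm]
    exact mul_le_mul_of_nonneg_right (hM s) (sub_nonneg.2 this)
  have b2 : |(∫ s in t₁..t₂, kker ρ α t₂ s * v s)| ≤ ∫ s in t₁..t₂, M * kker ρ α t₂ s := by
    rw [← Real.norm_eq_abs]
    apply intervalIntegral.norm_integral_le_of_norm_le h12 _ (i3.const_mul M)
    refine ae_of_all _ fun s hs => ?_
    have hk := kker_nonneg (α := α) hρ (h1'.trans hs.1) hs.2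
    rw [norm_mul, Real.norm_eq_abs, Real.norm_eq_abs, abs_of_nonneg hk, mul_comm]
    exact mul_le_mul_of_nonneg_right (hM s) hk
  rw [intervalIntegral.integral_sub j4 j1] at b1
  rw [intervalIntegral.integral_const_mul, intervalIntegral.integral_sub i1 i4] at b1
  rw [intervalIntegral.integral_const_mul] at b2
  have mono : ((t₁ ^ ρ - a ^ ρ) / ρ) ^ α / α ≤ ((t₂ ^ ρ - a ^ ρ) / ρ) ^ α / α := by
    have : a ^ ρ ≤ t₁ ^ ρ := Real.rpow_le_rpow ha.le h1 hρ.le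
    have : 0 ≤ (t₁ ^ ρ - a ^ ρ) / ρ := div_nonneg (by linarith) hρ.le
    gcongr
  rw [← f4]
  rw [e2, e3] at e4
  rw [e1] at b1
  rw [e3] at b2
  set W := ((t₂ ^ ρ - t₁ ^ ρ) / ρ) ^ α
  have hh : 2 * M / α * W = M * (W / α) + M * (W / α) := by ring
  rw [hh]
  have b1' := b1.trans (mul_le_mul_of_nonneg_left (show _ ≤ W / α by linarith) hM0)
  rw [abs_le] at b1' b2 ⊢
  constructor <;> linarith [b1'.1, b1'.2, b2.1, b2.2]

lemma kker_diff' {ρ α a t₁ t₂ M : ℝ} (hρ : 0 < ρ) (hα : 0 < α) (hα1 : α < 1) (ha : 0 < a)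
    (h1 : a ≤ t₁) (h2 : a ≤ t₂) {v : ℝ → ℝ} (hv : Measurable v) (hM : ∀ s, |v s| ≤ M) :
    |(∫ s in a..t₂, kker ρ α t₂ s * v s) - ∫ s in a..t₁, kker ρ α t₁ s * v s| ≤
      2 * M / α * (|t₂ ^ ρ - t₁ ^ ρ| / ρ) ^ α := by
  rcases le_total t₁ t₂ with h | h
  · have := Real.rpow_le_rpow (ha.le.trans h1) h hρ.le
    rw [abs_of_nonneg (sub_nonneg.2 this)]
    exact kker_diff hρ hα hα1 ha h1 h hv hM
  · have := Real.rpow_le_rpow (ha.le.trans h2) h hρ.le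
    rw [abs_sub_comm, abs_sub_comm (t₂ ^ ρ), abs_of_nonneg (sub_nonneg.2 this)]
    exact kker_diff hρ hα hα1 ha h2 h hv hM

noncomputable def clampI (a b t : ℝ) : ℝ := max a (min b t)

lemma clampI_ge (a b t : ℝ) : a ≤ clampI a b t := le_max_left _ _
lemma clampI_le {a b : ℝ} (hab : a ≤ b) (t : ℝ) : clampI a b t ≤ b := max_le hab (min_le_left _ _)
lemma clampI_eq {a b t : ℝ} (h1 : a ≤ t) (h2 : t ≤ b) : clampI a b t = t := by
  simp [clampI, h1, h2]
lemma clampI_cont (a b : ℝ) : Continuous (clampI a b) := by unfold clampI; fun_prop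

noncomputable def TT (ρ α a b : ℝ) (F : ℝ → ℝ → ℝ) (δ : ℝ) (u : ℝ → ℝ) (t : ℝ) : ℝ :=
  ∫ s in a..clampI a b t, kker ρ α (clampI a b t) s * F s (u (s - δ))

section
variable {ρ α a b M : ℝ} (hρ : 0 < ρ) (hα : 0 < α) (hα1 : α < 1) (ha : 0 < a) (hab : a < b)
  {F : ℝ → ℝ → ℝ} (hFm : Measurable (Function.uncurry F)) (hFM : ∀ s u, |F s u| ≤ M)

include hFm in
lemma meas_comp {u : ℝ → ℝ} (hu : Measurable u) (δ : ℝ) :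
    Measurable fun s => F s (u (s - δ)) :=
  hFm.comp (measurable_id.prodMk (hu.comp (measurable_id.sub_const δ)))

include hρ hα hα1 ha hFm hFM in
lemma TT_diff {u : ℝ → ℝ} (hu : Measurable u) (δ t₁ t₂ : ℝ) :
    |TT ρ α a b F δ u t₂ - TT ρ α a b F δ u t₁| ≤
      2 * M / α * (|clampI a b t₂ ^ ρ - clampI a b t₁ ^ ρ| / ρ) ^ α :=
  kker_diff' hρ hα hα1 ha (clampI_ge _ _ _) (clampI_ge _ _ _) (meas_comp hFm hu δ)
    (fun s => hFM s _)

include hρ hα ha in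
lemma modulus_tendsto (M b t₀ : ℝ) :
    Tendsto (fun t => 2 * M / α * (|clampI a b t ^ ρ - clampI a b t₀ ^ ρ| / ρ) ^ α) (𝓝 t₀) (𝓝 0) := by
  have : Continuous (fun t => 2 * M / α * (|clampI a b t ^ ρ - clampI a b t₀ ^ ρ| / ρ) ^ α) := by
    apply Continuous.mul continuous_const
    apply Continuous.rpow_const _ (fun _ => Or.inr hα.le)
    apply Continuous.div_const
    apply Continuous.abs
    apply Continuous.sub _ continuous_const
    exact (clampI_cont a b).rpow_const (fun _ => Or.inr hρ.le)
  have h := this.tendsto t₀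
  simpa [Real.zero_rpow hα.ne'] using h

include hρ hα hα1 ha hFm hFM in
lemma TT_cont {u : ℝ → ℝ} (hu : Measurable u) (δ : ℝ) : Continuous (TT ρ α a b F δ u) := by
  rw [continuous_iff_continuousAt]
  intro t₀
  rw [ContinuousAt, tendsto_iff_dist_tendsto_zero]
  refine squeeze_zero (fun _ => dist_nonneg) (fun t => ?_) (modulus_tendsto hρ hα ha M b t₀)
  rw [Real.dist_eq]
  exact TT_diff hρ hα hα1 ha hFm hFM hu δ t₀ t

include hab in
lemma TT_congr {u u' : ℝ → ℝ} {δ t : ℝ}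
    (h : ∀ s, a < s → s ≤ b → s ≤ t → u (s - δ) = u' (s - δ)) :
    TT ρ α a b F δ u t = TT ρ α a b F δ u' t := by
  unfold TT
  apply intervalIntegral.integral_congr_uIoo
  intro s hs
  rw [Set.uIoo_of_le (clampI_ge _ _ _)] at hs
  have h1 : s < b := hs.2.trans_le (clampI_le hab.le t)
  have h2 : s < t := by
    have := hs.2
    unfold clampI at this
    rcases lt_max_iff.1 this with h | h
    · exact absurd h hs.1.not_gt
    · exact (lt_min_iff.1 h).2
  simp only [h s hs.1 h1.le h2.le]

include hρ hα hα1 ha hab hFm hFM in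
lemma exists_delay {δ : ℝ} (hδ : 0 < δ) :
    ∃ y : ℝ → ℝ, Continuous y ∧ ∀ t, y t = TT ρ α a b F δ y t := by
  let Y : ℕ → ℝ → ℝ := fun j => (TT ρ α a b F δ)^[j] (fun _ => 0)
  have hYs : ∀ j, Y (j + 1) = TT ρ α a b F δ (Y j) := fun j =>
    Function.iterate_succ_apply' _ _ _
  have hYm : ∀ j, Measurable (Y j) := by
    intro j
    induction j with
    | zero => exact measurable_const
    | succ j ih => rw [hYs]; exact (TT_cont hρ hα hα1 ha hFm hFM ih δ).measurable
  have key : ∀ j : ℕ, ∀ t ≤ a + j * δ, Y (j + 1) t = Y j t := by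
    intro j
    induction j with
    | zero =>
      intro t ht
      have ht : t ≤ a := by simpa using ht
      rw [hYs]
      have : clampI a b t = a := by simp [clampI, ht]
      simp [TT, this, Y]
    | succ j ih =>
      intro t ht
      rw [hYs (j + 1), hYs j]
      push_cast at ht
      refine TT_congr hab fun s _ _ hs => ?_
      rw [← hYs j]
      exact ih _ (by linarith)
  obtain ⟨N, hN⟩ := exists_nat_ge ((b - a) / δ)
  have hN' : b ≤ a + N * δ := by
    rw [div_le_iff₀ hδ] at hN; linarith
  refine ⟨Y (N + 1), ?_, fun t => ?_⟩
  · rw [hYs]; exact TT_cont hρ hα hα1 ha hFm hFM (hYm N) δ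
  · rw [hYs N]
    refine TT_congr hab fun s _ hs _ => ?_
    rw [← hYs N]
    exact (key N _ (by linarith)).symm

include hρ hα hα1 ha hab hFm hFM in
lemma core (hFc : ∀ s, Continuous (F s)) :
    ∃ y : ℝ → ℝ, Continuous y ∧ ∀ t ∈ Set.Icc a b,
      y t = ∫ s in a..t, kker ρ α t s * F s (y s) := by
  let δ : ℕ → ℝ := fun n => 1 / ((n : ℝ) + 1)
  have hδ : ∀ n, 0 < δ n := fun n => by positivity
  choose Y hYc hY using fun n => exists_delay hρ hα hα1 ha hab hFm hFM (hδ n)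
  have hdiff : ∀ n t₁ t₂, |Y n t₂ - Y n t₁| ≤
      2 * M / α * (|clampI a b t₂ ^ ρ - clampI a b t₁ ^ ρ| / ρ) ^ α := by
    intro n t₁ t₂
    rw [hY n t₁, hY n t₂]
    exact TT_diff hρ hα hα1 ha hFm hFM (hYc n).measurable _ _ _
  have hM0 : 0 ≤ M := (abs_nonneg _).trans (hFM 0 0)
  have hYa : ∀ n, Y n a = 0 := fun n => by
    rw [hY n a, TT, clampI_eq le_rfl hab.le, intervalIntegral.integral_same]
  obtain ⟨C, hC⟩ : ∃ C, ∀ t ∈ Set.Icc a b,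
      2 * M / α * (|clampI a b t ^ ρ - clampI a b a ^ ρ| / ρ) ^ α ≤ C := by
    have : Continuous (fun t => 2 * M / α * (|clampI a b t ^ ρ - clampI a b a ^ ρ| / ρ) ^ α) := by
      apply Continuous.mul continuous_const
      apply Continuous.rpow_const _ (fun _ => Or.inr hα.le)
      apply Continuous.div_const
      apply Continuous.abs
      apply Continuous.sub _ continuous_const
      exact (clampI_cont a b).rpow_const (fun _ => Or.inr hρ.le)
    obtain ⟨C, hC⟩ := (isCompact_Icc (a := a) (b := b)).bddAbove_image this.continuousOn
    exact ⟨C, fun t ht => hC ⟨t, ht, rfl⟩⟩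
  let G : ℕ → BoundedContinuousFunction (Set.Icc a b) ℝ := fun n =>
    BoundedContinuousFunction.mkOfCompact ⟨fun t => Y n t, (hYc n).comp continuous_subtype_val⟩
  have hcomp : IsCompact (closure (Set.range G)) := by
    refine BoundedContinuousFunction.arzela_ascoli (Set.Icc (-C) C) isCompact_Icc _ ?_ ?_
    · rintro _ x ⟨n, rfl⟩
      have h := (hdiff n a x).trans (hC x x.2)
      rw [hYa, sub_zero] at h
      exact abs_le.1 h
    · intro x
      refine Metric.equicontinuousAt_of_continuity_modulus
        (fun t : Set.Icc a b => 2 * M / α * (|clampI a b t ^ ρ - clampI a b x ^ ρ| / ρ) ^ α)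
        ((modulus_tendsto hρ hα ha M b x).comp continuous_subtype_val.continuousAt) _ ?_
      refine Eventually.of_forall ?_
      rintro t ⟨_, ⟨n, rfl⟩⟩
      rw [dist_comm]
      exact hdiff n x t
  obtain ⟨g, -, φ, hφ, hlim⟩ := hcomp.tendsto_subseq (fun n => subset_closure (Set.mem_range_self n))
  have hptw : ∀ t (ht : t ∈ Set.Icc a b), Tendsto (fun n => Y (φ n) t) atTop (𝓝 (g ⟨t, ht⟩)) :=
    fun t ht => ((continuous_eval_const (F := BoundedContinuousFunction (Set.Icc a b) ℝ) (⟨t, ht⟩ : Set.Icc a b)).tendsto g).comp hlim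
  let y : ℝ → ℝ := Set.IccExtend hab.le g
  have hyc : Continuous y := g.continuous.Icc_extend'
  have hye : ∀ t (ht : t ∈ Set.Icc a b), y t = g ⟨t, ht⟩ := fun t ht => Set.IccExtend_of_mem _ _ ht
  have hδ0 : Tendsto (fun n => δ (φ n)) atTop (𝓝 0) :=
    tendsto_one_div_add_atTop_nhds_zero_nat.comp hφ.tendsto_atTop
  have hptw' : ∀ s ∈ Set.Icc a b, Tendsto (fun n => Y (φ n) (s - δ (φ n))) atTop (𝓝 (y s)) := by
    intro s hs
    have h1 : Tendsto (fun n => s - δ (φ n)) atTop (𝓝 s) := by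
      simpa using hδ0.const_sub s
    have h2 : Tendsto (fun n => Y (φ n) (s - δ (φ n)) - Y (φ n) s) atTop (𝓝 0) :=
      squeeze_zero_norm (fun n => hdiff (φ n) s _) ((modulus_tendsto hρ hα ha M b s).comp h1)
    have h3 := h2.add (hptw s hs)
    rw [hye s hs]
    simpa using h3
  refine ⟨y, hyc, fun t ht => ?_⟩
  have hl : Tendsto (fun n => Y (φ n) t) atTop (𝓝 (y t)) := by
    rw [hye t ht]; exact hptw t ht
  refine tendsto_nhds_unique hl ?_
  have hrw : (fun n => Y (φ n) t) = fun n =>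
      ∫ s in a..t, kker ρ α t s * F s (Y (φ n) (s - δ (φ n))) := by
    funext n
    conv_lhs => rw [hY (φ n) t]
    rw [TT, clampI_eq ht.1 ht.2]
  rw [hrw]
  have hki := (kker_int hρ hα ha ht.1).1
  refine intervalIntegral.tendsto_integral_filter_of_dominated_convergence
    (fun s => kker ρ α t s * M) ?_ ?_ (hki.mul_const M) ?_
  · refine Eventually.of_forall fun n => ?_
    have := kker_mul_int hρ hα ha ht.1 (meas_comp hFm (hYc (φ n)).measurable (δ (φ n)))
      (fun s => hFM s _)
    rw [intervalIntegrable_iff] at this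
    exact this.aestronglyMeasurable
  · refine Eventually.of_forall fun n => ae_of_all _ fun s hs => ?_
    rw [Set.uIoc_of_le ht.1] at hs
    have hk := kker_nonneg (α := α) hρ (ha.trans hs.1) hs.2
    rw [norm_mul, Real.norm_eq_abs, Real.norm_eq_abs, abs_of_nonneg hk]
    exact mul_le_mul_of_nonneg_left (hFM _ _) hk
  · refine ae_of_all _ fun s hs => ?_
    rw [Set.uIoc_of_le ht.1] at hs
    exact (((hFc s).tendsto _).comp (hptw' s ⟨hs.1.le, hs.2.trans ht.2⟩)).const_mul _
end

lemma main_aux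
    (a b α β ρ γ c₂ : ℝ) (ha : 0 < a) (hab : a < b)
    (hα : 0 < α) (hα1 : α < 1) (hβ : 0 ≤ β) (hβ1 : β ≤ 1) (hρ : 0 < ρ)
    (hγ : γ = α + β * (1 - α))
    (f : ℝ → ℝ → ℝ)
    (hfmeas : ∀ u : ℝ, Measurable fun t => f t u)
    (hfcont : ∀ᵐ t ∂(volume.restrict (Set.Icc a b)), Continuous fun u : ℝ => f t u)
    (p : ℝ → ℝ) (hpc : ContinuousOn p (Set.Icc a b)) (hp0 : ∀ t ∈ Set.Icc a b, 0 ≤ p t)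
    (hfb : ∀ᵐ t ∂(volume.restrict (Set.Icc a b)), ∀ u : ℝ,
      |f t u| ≤ p t * |u| / (1 + |u|)) :
    ∃ x : ℝ → ℝ, (∃ X : ℝ → ℝ, ContinuousOn X (Set.Icc a b) ∧
    ∀ t ∈ Set.Ioc a b, X t = ((t ^ ρ - a ^ ρ) / ρ) ^ (1 - γ) * x t) ∧
      ∀ t ∈ Set.Ioc a b,
        x t = (c₂ / Real.Gamma γ) * ((t ^ ρ - a ^ ρ) / ρ) ^ (γ - 1) +
          (1 / Real.Gamma α) *
            ∫ s in a..t, s ^ (ρ - 1) * ((t ^ ρ - s ^ ρ) / ρ) ^ (α - 1) * f s (x s) := by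
  classical
  obtain ⟨P, hP⟩ := (isCompact_Icc (a := a) (b := b)).bddAbove_image hpc
  have hP' : ∀ t ∈ Set.Icc a b, p t ≤ P := fun t ht => hP ⟨t, ht, rfl⟩
  have hP0 : 0 ≤ P := (hp0 a ⟨le_rfl, hab.le⟩).trans (hP' a ⟨le_rfl, hab.le⟩)
  have hgood : ∀ᵐ t ∂(volume.restrict (Set.Icc a b)),
      Continuous (fun u : ℝ => f t u) ∧ ∀ u, |f t u| ≤ P := by
    filter_upwards [hfcont, hfb, ae_restrict_mem measurableSet_Icc] with t h1 h2 ht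
    refine ⟨h1, fun u => (h2 u).trans ?_⟩
    rw [div_le_iff₀ (by positivity)]
    have := hP' t ht
    have := hp0 t ht
    have := abs_nonneg u
    nlinarith
  obtain ⟨S, hS, hSm, hSae⟩ := hgood.exists_measurable_mem
  let w : ℝ → ℝ := fun t => (t ^ ρ - a ^ ρ) / ρ
  let h : ℝ → ℝ := fun t => (c₂ / Real.Gamma γ) * w t ^ (γ - 1)
  have hwc : Continuous w := (((Real.continuous_rpow_const hρ.le)).sub continuous_const).div_const _
  have hhm : Measurable h := (hwc.measurable.pow_const _).const_mul _
  let F0 : ℝ → ℝ → ℝ := fun s u => if s ∈ S then f s u else 0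
  have hF0c : ∀ s, Continuous fun u => F0 s u := by
    intro s
    by_cases hs : s ∈ S
    · simpa [F0, hs] using (hSae s hs).1
    · simpa [F0, hs] using continuous_const
  have hF0m : Measurable (Function.uncurry F0) := by
    have := measurable_uncurry_of_continuous_of_measurable (u := fun u s => F0 s u) hF0c
      (fun u => Measurable.ite hSm (hfmeas u) measurable_const)
    exact this.comp measurable_swap
  have hF0b : ∀ s u, |F0 s u| ≤ P := by
    intro s u
    by_cases hs : s ∈ S
    · simpa [F0, hs] using (hSae s hs).2 u
    · simpa [F0, hs] using hP0
  let F : ℝ → ℝ → ℝ := fun s u => (1 / Real.Gamma α) * F0 s (h s + u)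
  have hFm : Measurable (Function.uncurry F) := by
    refine Measurable.const_mul ?_ _
    exact hF0m.comp (measurable_fst.prodMk ((hhm.comp measurable_fst).add measurable_snd))
  have hFc : ∀ s, Continuous (F s) := fun s =>
    continuous_const.mul ((hF0c s).comp (continuous_const.add continuous_id))
  have hFM : ∀ s u, |F s u| ≤ |1 / Real.Gamma α| * P := fun s u => by
    rw [abs_mul]; exact mul_le_mul_of_nonneg_left (hF0b _ _) (abs_nonneg _)
  obtain ⟨y, hyc, hy⟩ := core hρ hα hα1 ha hab hFm hFM hFc
  have hγ1 : 0 ≤ 1 - γ := by rw [hγ]; nlinarith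
  refine ⟨fun t => h t + y t, ⟨fun t => c₂ / Real.Gamma γ + w t ^ (1 - γ) * y t, ?_, ?_⟩, ?_⟩
  · exact (continuous_const.add ((hwc.rpow_const (fun _ => Or.inr hγ1)).mul hyc)).continuousOn
  · intro t ht
    have hw : 0 < w t := div_pos (sub_pos.2 (Real.rpow_lt_rpow ha.le ht.1 hρ)) hρ
    have : w t ^ (1 - γ) * w t ^ (γ - 1) = 1 := by
      rw [← Real.rpow_add hw]; simp
    show c₂ / Real.Gamma γ + w t ^ (1 - γ) * y t =
      w t ^ (1 - γ) * ((c₂ / Real.Gamma γ) * w t ^ (γ - 1) + y t)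
    linear_combination (-(c₂ / Real.Gamma γ)) * this
  · intro t ht
    show h t + y t = h t + _
    rw [hy t ⟨ht.1.le, ht.2⟩, ← intervalIntegral.integral_const_mul]
    congr 1
    apply intervalIntegral.integral_congr_ae
    have hS' := (ae_restrict_iff' measurableSet_Icc).1 hS
    filter_upwards [hS'] with s hs hst
    rw [Set.uIoc_of_le ht.1.le] at hst
    have : s ∈ S := hs ⟨hst.1.le, hst.2.trans ht.2⟩
    simp only [F, F0, this, if_true, kker]
    ring

/-- Existence of at least one solution of the IVP for the generalized Katugampola
fractional differential equation on `[a,b]`, via its integral formulation. -/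
theorem exists_solution_IVP
    (a b α β ρ γ c₂ : ℝ) (ha : 0 < a) (hab : a < b)
    (hα : 0 < α) (hα1 : α < 1) (hβ : 0 ≤ β) (hβ1 : β ≤ 1) (hρ : 0 < ρ)
    (hγ : γ = α + β * (1 - α))
    (f : ℝ → ℝ → ℝ)
    (hfmeas : ∀ u : ℝ, Measurable fun t => f t u)
    (hfcont : ∀ᵐ t ∂(volume.restrict (Set.Icc a b)), Continuous fun u : ℝ => f t u)
    (p : ℝ → ℝ) (hpc : ContinuousOn p (Set.Icc a b)) (hp0 : ∀ t ∈ Set.Icc a b, 0 ≤ p t)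
    (hfb : ∀ᵐ t ∂(volume.restrict (Set.Icc a b)), ∀ u : ℝ,
      |f t u| ≤ p t * |u| / (1 + |u|)) :
    ∃ x : ℝ → ℝ, MemCgr ρ a b γ x ∧
      ∀ t ∈ Set.Ioc a b,
        x t = (c₂ / Real.Gamma γ) * ((t ^ ρ - a ^ ρ) / ρ) ^ (γ - 1) +
          (1 / Real.Gamma α) *
            ∫ s in a..t, s ^ (ρ - 1) * ((t ^ ρ - s ^ ρ) / ρ) ^ (α - 1) * f s (x s) := by
  exact main_aux a b α β ρ γ c₂ ha hab hα hα1 hβ hβ1 hρ hγ f hfmeas hfcont p hpc hp0 hfb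
end

section
/- Let 0 < a < b, 0 < α < 1, 0 ≤ β ≤ 1, ρ > 0, γ = α + β(1-α), and c₂ ∈ ℝ. Let f : [a,b] × ℝ → ℝ be such that t ↦ f(t,x) is measurable for each x and x ↦ f(t,x) is continuous for almost every t, and let p : [a,b] → [0,∞) be continuous with |f(t,x)| ≤ p(t)|x|/(1 + |x|) for almost every t and all x ∈ ℝ. Let Φ : [a,b] → [0,∞) be continuous and suppose there exists λ_Φ > 0 with (ρI_{a+}^α Φ)(t) ≤ λ_Φ Φ(t) for every t ∈ (a,b], and suppose there exists a continuous q : [a,b] → [0,∞) with p(t) ≤ q(t)Φ(t) for every t ∈ [a,b]; set q* := sup_{t ∈ [a,b]} q(t). Let x ∈ C_{γ,ρ}([a,b]) satisfy |x(t) - (c₂/Γ(γ)) ((t^ρ - a^ρ)/ρ)^{γ-1} - (ρI_{a+}^α f(·, x(·)))(t)| ≤ Φ(t) for all t ∈ (a,b], and let x̄ ∈ C_{γ,ρ}([a,b]) satisfy the integral equation x̄(t) = (c₂/Γ(γ)) ((t^ρ - a^ρ)/ρ)^{γ-1} + (ρI_{a+}^α f(·, x̄(·)))(t) for all t ∈ (a,b].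 Then |x(t) - x̄(t)| ≤ (1 + 2 q* λ_Φ) Φ(t) for all t ∈ (a,b]; in particular the problem is generalized Ulam-Hyers-Rassias stable with respect to Φ. -/
open Real Filter Topology intervalIntegral MeasureTheory

theorem kat_kernel_integrable (ρ a α t : ℝ) (ha : 0 < a) (hα : 0 < α) (hρ : 0 < ρ)
    (hat : a < t) :
    IntervalIntegrable (fun s => s ^ (ρ - 1) * ((t ^ ρ - s ^ ρ) / ρ) ^ (α - 1)) volume a t := by
  have hlt : ∀ s ∈ Set.Ioo a t, 0 < (t ^ ρ - s ^ ρ) / ρ := fun s hs =>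
    div_pos (sub_pos.2 (Real.rpow_lt_rpow (ha.trans hs.1).le hs.2 hρ)) hρ
  apply intervalIntegrable_deriv_of_nonneg (g := fun s => -(((t ^ ρ - s ^ ρ) / ρ) ^ α / α))
  · refine ContinuousOn.neg (ContinuousOn.div_const (ContinuousOn.rpow_const ?_ ?_) _)
    · refine ContinuousOn.div_const (continuousOn_const.sub ?_) _
      exact (Real.continuous_rpow_const hρ.le).continuousOn
    · intro s _
      exact Or.inr hα.le
  · rw [min_eq_left hat.le, max_eq_right hat.le]
    intro s hs
    have hs0 : 0 < s := ha.trans hs.1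
    have h1 : HasDerivAt (fun s : ℝ => s ^ ρ) (ρ * s ^ (ρ - 1)) s :=
      Real.hasDerivAt_rpow_const (Or.inl hs0.ne')
    have h2 := (((h1.const_sub (t ^ ρ)).div_const ρ).rpow_const (p := α)
      (Or.inl (hlt s hs).ne')).div_const α |>.neg
    refine HasDerivAt.congr_deriv h2 ?_
    field_simp
  · rw [min_eq_left hat.le, max_eq_right hat.le]
    intro s hs
    have hs0 : 0 < s := ha.trans hs.1
    have := hlt s hs
    positivity

theorem kat_bound_s12 (ρ a b α t Q : ℝ) (ha : 0 < a) (hα : 0 < α) (hρ : 0 < ρ)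
    (ht : t ∈ Set.Ioc a b) (Φ g : ℝ → ℝ) (hΦc : ContinuousOn Φ (Set.Icc a b))
    (hg : ∀ᵐ s ∂(volume.restrict (Set.Icc a b)), |g s| ≤ Q * Φ s) :
    |katI ρ a α g t| ≤ Q * katI ρ a α Φ t := by
  have hint := (kat_kernel_integrable ρ a α t ha hα hρ ht.1).mul_continuousOn (g := Φ)
    (hΦc.mono (by rw [Set.uIcc_of_le ht.1.le]; exact Set.Icc_subset_Icc_right ht.2))
  have hG : 0 < Real.Gamma α := Real.Gamma_pos_of_pos hα
  have key : ‖∫ s in a..t, s ^ (ρ - 1) * ((t ^ ρ - s ^ ρ) / ρ) ^ (α - 1) * g s‖ ≤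
      ∫ s in a..t, Q * (s ^ (ρ - 1) * ((t ^ ρ - s ^ ρ) / ρ) ^ (α - 1) * Φ s) := by
    apply intervalIntegral.norm_integral_le_of_norm_le ht.1.le _ (hint.const_mul Q)
    rw [ae_restrict_iff' measurableSet_Icc] at hg
    filter_upwards [hg] with s hs hst
    have h := hs ⟨hst.1.le, hst.2.trans ht.2⟩
    have hs0 : 0 < s := ha.trans hst.1
    have h0 : 0 ≤ (t ^ ρ - s ^ ρ) / ρ :=
      div_nonneg (sub_nonneg.2 (Real.rpow_le_rpow hs0.le hst.2 hρ.le)) hρ.le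
    have hk : 0 ≤ s ^ (ρ - 1) * ((t ^ ρ - s ^ ρ) / ρ) ^ (α - 1) := by positivity
    rw [Real.norm_eq_abs, abs_mul, abs_of_nonneg hk]
    calc _ ≤ s ^ (ρ - 1) * ((t ^ ρ - s ^ ρ) / ρ) ^ (α - 1) * (Q * Φ s) :=
          mul_le_mul_of_nonneg_left h hk
      _ = _ := by ring
  rw [intervalIntegral.integral_const_mul, Real.norm_eq_abs] at key
  unfold katI
  rw [abs_mul, abs_of_pos (by positivity : 0 < 1 / Real.Gamma α)]
  calc _ ≤ 1 / Real.Gamma α * _ := mul_le_mul_of_nonneg_left key (by positivity)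
    _ = _ := by ring

/-- Generalized Ulam-Hyers-Rassias stability of the IVP for the generalized Katugampola
fractional differential equation. -/
theorem generalized_UHR_stability
    (a b α β ρ γ c₂ : ℝ) (ha : 0 < a) (hab : a < b)
    (hα : 0 < α) (hα1 : α < 1) (hβ : 0 ≤ β) (hβ1 : β ≤ 1) (hρ : 0 < ρ)
    (hγ : γ = α + β * (1 - α))
    (f : ℝ → ℝ → ℝ)
    (hfmeas : ∀ u : ℝ, Measurable fun t => f t u)
    (hfcont : ∀ᵐ t ∂(volume.restrict (Set.Icc a b)), Continuous fun u : ℝ => f t u)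
    (p : ℝ → ℝ) (hpc : ContinuousOn p (Set.Icc a b)) (hp0 : ∀ t ∈ Set.Icc a b, 0 ≤ p t)
    (hfb : ∀ᵐ t ∂(volume.restrict (Set.Icc a b)), ∀ u : ℝ,
      |f t u| ≤ p t * |u| / (1 + |u|))
    (Φ : ℝ → ℝ) (hΦc : ContinuousOn Φ (Set.Icc a b)) (hΦ0 : ∀ t ∈ Set.Icc a b, 0 ≤ Φ t)
    (lamΦ : ℝ) (hlam : 0 < lamΦ)
    (hΦI : ∀ t ∈ Set.Ioc a b, katI ρ a α Φ t ≤ lamΦ * Φ t)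
    (q : ℝ → ℝ) (hqc : ContinuousOn q (Set.Icc a b)) (hq0 : ∀ t ∈ Set.Icc a b, 0 ≤ q t)
    (hpq : ∀ t ∈ Set.Icc a b, p t ≤ q t * Φ t)
    (qstar : ℝ) (hqstar : IsGreatest (q '' Set.Icc a b) qstar)
    (x : ℝ → ℝ) (hx : MemCgr ρ a b γ x)
    (hxineq : ∀ t ∈ Set.Ioc a b,
      |x t - (c₂ / Real.Gamma γ) * ((t ^ ρ - a ^ ρ) / ρ) ^ (γ - 1) -
        katI ρ a α (fun s => f s (x s)) t| ≤ Φ t)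
    (x' : ℝ → ℝ) (hx' : MemCgr ρ a b γ x')
    (hx'eq : ∀ t ∈ Set.Ioc a b,
      x' t = (c₂ / Real.Gamma γ) * ((t ^ ρ - a ^ ρ) / ρ) ^ (γ - 1) +
        katI ρ a α (fun s => f s (x' s)) t) :
    ∀ t ∈ Set.Ioc a b, |x t - x' t| ≤ (1 + 2 * qstar * lamΦ) * Φ t := by
  intro t ht
  obtain ⟨⟨r, hr, hrq⟩, hub⟩ := hqstar
  have hQ0 : 0 ≤ qstar := hrq ▸ hq0 r hr
  have hb : ∀ y : ℝ → ℝ, |katI ρ a α (fun s => f s (y s)) t| ≤ qstar * (lamΦ * Φ t) := by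
    intro y
    refine (kat_bound_s12 ρ a b α t qstar ha hα hρ ht Φ _ hΦc ?_).trans
      (mul_le_mul_of_nonneg_left (hΦI t ht) hQ0)
    filter_upwards [hfb, ae_restrict_mem measurableSet_Icc] with s hs hsm
    have h1 : p s * |y s| / (1 + |y s|) ≤ p s := by
      rw [div_le_iff₀ (by positivity)]
      nlinarith [hp0 s hsm, abs_nonneg (y s)]
    have h2 : q s * Φ s ≤ qstar * Φ s :=
      mul_le_mul_of_nonneg_right (hub ⟨s, hsm, rfl⟩) (hΦ0 s hsm)
    linarith [hs (y s), hpq s hsm]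
  have e1 := abs_le.1 (hb x)
  have e2 := abs_le.1 (hb x')
  have e3 := abs_le.1 (hxineq t ht)
  have e4 := hx'eq t ht
  rw [abs_le]
  constructor <;> linarith [e1.1, e1.2, e2.1, e2.2, e3.1, e3.2]
end
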